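/- arXiv:2207.04289 — 3 statements merged into one kernel-verified Lean document; each statement's English description precedes it below -/
import Mathlib

section
/- Let F = (f₁,…,f_p) ∈ ℂ[X₁,…,X_n]^p with deg f_j ≤ d for all j, and fix i ∈ {1,…,n−p+1}. Suppose that 0 is a regular value of the n+p−i polynomials (f₁,…,f_p, the n−i entries of [L₁ ⋯ L_p]·jac(F,i)) on the open set {(x,ℓ) ∈ ℂⁿ × ℂ^p : ℓ ≠ 0}. Then there exists a nonzero polynomial Ξ_i ∈ ℂ[S₁,…,S_{i−1}] of total degree at most d^{4n} such that for every σ = (σ₁,…,σ_{i−1}) ∈ ℂ^{i−1} with Ξ_i(σ) ≠ 0, 0 is a regular value of the n+p−1 polynomials (X₁−σ₁,…,X_{i−1}−σ_{i−1}, f₁,…,f_p, the n−i entries of [L₁ ⋯ L_p]·jac(F,i)) on the open set {(x,ℓ) ∈ ℂⁿ × ℂ^p : ℓ ≠ 0}. -/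
open MvPolynomial

noncomputable section

/-- The Jacobian matrix of a family of polynomials, evaluated at a point. -/
def jacEval {ι σ : Type*} [Fintype ι] [Fintype σ]
    (G : ι → MvPolynomial σ ℂ) (y : σ → ℂ) : Matrix ι σ ℂ :=
  Matrix.of fun j k => eval y (pderiv k (G j))

/-- `0` is a regular value of `G` on `U`. -/
def IsRegularValueOn {ι σ : Type*} [Fintype ι] [Fintype σ]
    (G : ι → MvPolynomial σ ℂ) (U : Set (σ → ℂ)) : Prop :=
  ∀ y ∈ U, (∀ j, eval y (G j) = 0) → (jacEval G y).rank = Fintype.card ι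

/-- The index (as an element of `Fin n`) of the `c`-th of the last `n - i` variables. -/
def colIdx (n i : ℕ) (c : Fin (n - i)) : Fin n :=
  ⟨i + c, by have := c.isLt; omega⟩

/-- The `c`-th entry of the row vector `[L₁ ⋯ L_p]·jac(G, i)`. -/
def lagEntry {n p : ℕ} (G : Fin p → MvPolynomial (Fin n) ℂ) (i : ℕ) (c : Fin (n - i)) :
    MvPolynomial (Fin n ⊕ Fin p) ℂ :=
  ∑ k : Fin p, X (Sum.inr k) * rename Sum.inl (pderiv (colIdx n i c) (G k))

/-- The system of `n + p − i` polynomials `(G, [L₁ ⋯ L_p]·jac(G, i))`. -/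
def hSys {n p : ℕ} (G : Fin p → MvPolynomial (Fin n) ℂ) (i : ℕ) :
    (Fin p ⊕ Fin (n - i)) → MvPolynomial (Fin n ⊕ Fin p) ℂ :=
  Sum.elim (fun j => rename Sum.inl (G j)) (fun c => lagEntry G i c)

/-- The system of `n + p − 1` polynomials
`(X₁−σ₁,…,X_{i−1}−σ_{i−1}, G, [L₁ ⋯ L_p]·jac(G, i))`, for `σ ∈ ℂ^{i−1}`. -/
def fiberSys {n p : ℕ} (G : Fin p → MvPolynomial (Fin n) ℂ) (i : ℕ)
    (hin : i - 1 ≤ n) (σ : Fin (i - 1) → ℂ) :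
    (Fin (i - 1) ⊕ (Fin p ⊕ Fin (n - i))) → MvPolynomial (Fin n ⊕ Fin p) ℂ :=
  Sum.elim
    (fun t => X (Sum.inl (Fin.castLE hin t)) - C (σ t))
    (hSys G i)

section Differentials

open KaehlerDifferential TensorProduct

lemma linearIndependent_D_algebraMap_X {ι k L : Type} [Field k] [CharZero k] [Field L]
    [Algebra k L] [Algebra (MvPolynomial ι k) L] [IsScalarTower k (MvPolynomial ι k) L]
    (hinj : Function.Injective (algebraMap (MvPolynomial ι k) L)) :
    LinearIndependent L fun t : ι =>
      D k L (algebraMap (MvPolynomial ι k) L (X t)) := by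
  have : FaithfulSMul (MvPolynomial ι k) L := (faithfulSMul_iff_algebraMap_injective _ _).mpr hinj
  let K := FractionRing (MvPolynomial ι k)
  let _ : Algebra K L := FractionRing.liftAlgebra (MvPolynomial ι k) L
  have : IsScalarTower (MvPolynomial ι k) K L := inferInstance
  have : CharZero K := algebraRat.charZero K
  have h1 : Algebra.FormallySmooth K L := by
    obtain ⟨s, hs⟩ := exists_isTranscendenceBasis K L
    have := hs.isAlgebraic_field
    exact .of_algebraicIndependent_of_isSeparable hs.1
  have h2 : Algebra.FormallyEtale (MvPolynomial ι k) K :=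
    Algebra.FormallyEtale.of_isLocalization (nonZeroDivisors (MvPolynomial ι k))
  have h3 : Algebra.FormallySmooth (MvPolynomial ι k) L :=
    Algebra.FormallySmooth.comp (MvPolynomial ι k) K L
  have hinj : Function.Injective (mapBaseChange k (MvPolynomial ι k) L) := by
    rw [injective_iff_map_eq_zero]
    intro x hx
    obtain ⟨x, rfl⟩ := (Algebra.H1Cotangent.exact_δ_mapBaseChange k (MvPolynomial ι k) L x).mp hx
    rw [Subsingleton.elim x 0, map_zero]
  have hb := ((mvPolynomialBasis k ι).baseChange L).linearIndependent.map'
    (mapBaseChange k (MvPolynomial ι k) L) (LinearMap.ker_eq_bot.mpr hinj)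
  have he : (fun t : ι => D k L (algebraMap (MvPolynomial ι k) L (X t))) =
      mapBaseChange k (MvPolynomial ι k) L ∘ (mvPolynomialBasis k ι).baseChange L := by
    ext t
    simp [mvPolynomialBasis_apply]
  rw [he]
  exact hb

lemma linearIndependent_D_of_injective_aeval {ι L : Type} [Field L] [Algebra ℂ L] (s : ι → L)
    (hinj : Function.Injective (aeval s : MvPolynomial ι ℂ →ₐ[ℂ] L)) :
    LinearIndependent L fun t => D ℂ L (s t) := by
  let _ : Algebra (MvPolynomial ι ℂ) L := (aeval s : MvPolynomial ι ℂ →ₐ[ℂ] L).toRingHom.toAlgebra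
  have hB : ∀ ξ, algebraMap (MvPolynomial ι ℂ) L ξ = aeval s ξ := fun _ => rfl
  have : IsScalarTower ℂ (MvPolynomial ι ℂ) L := IsScalarTower.of_algebraMap_eq fun c => by
    rw [hB, AlgHom.commutes]
  simpa [hB] using linearIndependent_D_algebraMap_X (k := ℂ) (L := L) (ι := ι) hinj

lemma D_aeval_eq_sum {v L : Type} [Fintype v] [Field L] [Algebra ℂ L]
    (x : v → L) (f : MvPolynomial v ℂ) :
    D ℂ L (aeval x f) = ∑ a, aeval x (pderiv a f) • D ℂ L (x a) := by
  classical
  induction f using MvPolynomial.induction_on with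
  | C c => simp
  | add f g hf hg => simp [hf, hg, add_smul, Finset.sum_add_distrib]
  | mul_X f a hf =>
    simp [hf, Derivation.leibniz, pderiv_X, add_smul, Finset.sum_add_distrib, Finset.smul_sum,
      smul_smul, Pi.single_apply, mul_comm, ite_smul, apply_ite]
    exact add_comm _ _

/-- A relation between the differentials of algebraically independent elements and of elements
which vanish only involves the latter. -/
lemma eq_zero_of_sum_mul_pderiv_eq_zero {v γ ι L : Type} [Fintype v] [Fintype γ] [Fintype ι]
    [Field L] [Algebra ℂ L] (x : v → L) (S : ι → v) (g : γ → MvPolynomial v ℂ)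
    (hinj : Function.Injective (aeval (x ∘ S) : MvPolynomial ι ℂ →ₐ[ℂ] L))
    (hg : ∀ j, aeval x (g j) = 0) (w : ι ⊕ γ → L)
    (hrow : ∀ k, ∑ a, w a * aeval x (pderiv k (Sum.elim (fun t => X (S t)) g a)) = 0) (t : ι) :
    w (Sum.inl t) = 0 := by
  refine Fintype.linearIndependent_iff.mp (linearIndependent_D_of_injective_aeval _ hinj)
    (fun t => w (Sum.inl t)) ?_ t
  have h1 : ∑ a, w a • D ℂ L (aeval x (Sum.elim (fun t => X (S t)) g a)) = 0 := by
    simp_rw [D_aeval_eq_sum, Finset.smul_sum, smul_smul]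
    rw [Finset.sum_comm]
    refine Finset.sum_eq_zero fun k _ => ?_
    rw [← Finset.sum_smul, hrow, zero_smul]
  rw [Fintype.sum_sum_type] at h1
  simpa [hg] using h1

/-- The Jacobian determinant of the coordinates `S` together with the polynomials `g`. -/
def paramJacobian {v γ ι : Type} [Fintype γ] [Fintype ι] [DecidableEq γ] [DecidableEq ι]
    (S : ι → v) (g : γ → MvPolynomial v ℂ) (e : ι ⊕ γ ≃ v) : MvPolynomial v ℂ :=
  (Matrix.of fun a b => pderiv (e b) (Sum.elim (fun t => X (S t)) g a)).det

/-- An algebraic form of the Sard theorem for the projection onto the coordinates `S`. -/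
lemma exists_rename_mem_span_paramJacobian {v γ ι : Type} [Fintype v] [Fintype γ] [Fintype ι]
    [DecidableEq γ] [DecidableEq ι] (S : ι → v) (g : γ → MvPolynomial v ℂ) (e : ι ⊕ γ ≃ v) (t₀ : ι)
    (hreg : ∀ y : v → ℂ, (∀ j, eval y (g j) = 0) → y (S t₀) ≠ 0 →
      ∀ b : γ → ℂ, (∀ k, ∑ j, b j * eval y (pderiv k (g j)) = 0) → b = 0) :
    ∃ ξ : MvPolynomial ι ℂ, ξ ≠ 0 ∧
      rename S ξ ∈ Ideal.span (insert (paramJacobian S g e) (Set.range g)) := by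
  by_contra! hcon
  set I := Ideal.span (insert (paramJacobian S g e) (Set.range g)) with hI
  obtain ⟨P, hP, hIP, hdisj⟩ := I.exists_le_prime_disjoint
    ((nonZeroDivisors (MvPolynomial ι ℂ)).map (rename S : MvPolynomial ι ℂ →ₐ[ℂ] _)) (by
      rw [Set.disjoint_left]
      rintro _ hx ⟨ξ, hξ, rfl⟩
      exact hcon ξ (nonZeroDivisors.ne_zero hξ) hx)
  have hparam : ∀ ξ : MvPolynomial ι ℂ, ξ ≠ 0 → rename S ξ ∉ P := fun ξ hξ hm =>
    Set.disjoint_left.mp hdisj hm ⟨ξ, mem_nonZeroDivisors_of_ne_zero hξ, rfl⟩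
  let L := FractionRing (MvPolynomial v ℂ ⧸ P)
  let π : MvPolynomial v ℂ →ₐ[ℂ] L := IsScalarTower.toAlgHom ℂ _ L
  have hπ : ∀ f, π f = algebraMap (MvPolynomial v ℂ ⧸ P) L (Ideal.Quotient.mk P f) := fun f =>
    IsScalarTower.algebraMap_apply (MvPolynomial v ℂ) (MvPolynomial v ℂ ⧸ P) L f
  have hker : ∀ f, π f = 0 ↔ f ∈ P := fun f => by
    rw [hπ, FaithfulSMul.algebraMap_eq_zero_iff, Ideal.Quotient.eq_zero_iff_mem]
  have hg : ∀ j, π (g j) = 0 := fun j => (hker _).2 <| hIP <|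
    Ideal.subset_span <| Set.mem_insert_of_mem _ ⟨j, rfl⟩
  have hJ : π (paramJacobian S g e) = 0 := (hker _).2 <| hIP <|
    Ideal.subset_span <| Set.mem_insert _ _
  rw [paramJacobian, AlgHom.map_det] at hJ
  obtain ⟨w, hw0, hw⟩ := Matrix.exists_vecMul_eq_zero_iff.mpr hJ
  have hrow : ∀ k, ∑ a, w a * π (pderiv k (Sum.elim (fun t => X (S t)) g a)) = 0 := fun k => by
    simpa [Matrix.vecMul, dotProduct] using congrFun hw (e.symm k)
  have hπx : ∀ f, π f = aeval (fun k => π (X k)) f := fun f => by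
    simpa using comp_aeval_apply (f := X) π f
  have hw1 : ∀ t, w (Sum.inl t) = 0 := by
    refine eq_zero_of_sum_mul_pderiv_eq_zero (fun k => π (X k)) S g ?_ ?_ w ?_
    · rw [injective_iff_map_eq_zero]
      intro ξ hξ
      by_contra hne
      refine hparam ξ hne ((hker _).1 ?_)
      rwa [hπx, aeval_rename]
    · simpa only [← hπx] using hg
    · simpa only [← hπx] using hrow
  obtain ⟨b, hb⟩ := IsLocalization.exist_integer_multiples_of_finite
    (nonZeroDivisors (MvPolynomial v ℂ ⧸ P)) (fun j => w (Sum.inr j))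
  choose c hc using hb
  choose r hr using fun j => Ideal.Quotient.mk_surjective (c j)
  have hr' : ∀ j, π (r j) = algebraMap _ L (b : MvPolynomial v ℂ ⧸ P) * w (Sum.inr j) := fun j => by
    rw [hπ, hr, hc, Algebra.smul_def]
  obtain ⟨j₀, hj₀⟩ : ∃ j, w (Sum.inr j) ≠ 0 := by
    by_contra! h
    exact hw0 (funext fun a => by cases a <;> simp [hw1, h])
  have hmem : r j₀ * X (S t₀) ∉ P := by
    intro h
    rcases hP.mem_or_mem h with h | h
    · rw [← hker, hr'] at h
      exact (mul_ne_zero (by simp) hj₀) h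
    · exact hparam (X t₀) (X_ne_zero _) (by simpa using h)
  rw [← IsPrime.vanishingIdeal_zeroLocus (K := ℂ) P, mem_vanishingIdeal_iff] at hmem
  push Not at hmem
  obtain ⟨y, hy, hy'⟩ := hmem
  rw [mem_zeroLocus_iff] at hy
  simp only [aeval_eq_eval, map_mul, eval_X, ne_eq, mul_eq_zero, not_or] at hy hy'
  refine hy'.1 (congrFun (hreg y (fun j => hy _ ((hker _).1 (hg j))) hy'.2
    (fun j => eval y (r j)) fun k => ?_) j₀)
  have : ∑ j, r j * pderiv k (g j) ∈ P := by
    rw [← hker, map_sum]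
    have h := hrow k
    rw [Fintype.sum_sum_type] at h
    simp only [hw1, zero_mul, Finset.sum_const_zero, zero_add, Sum.elim_inr] at h
    simp_rw [map_mul, hr', mul_assoc, ← Finset.mul_sum, h, mul_zero]
  simpa using hy _ this

end Differentials

lemma natDegree_prod_pow_le {ο R : Type} [CommRing R] (φ : ο → Polynomial R)
    (hφ : ∀ o, (φ o).natDegree ≤ 1) (m : ο → ℕ) (s : Finset ο) :
    (∏ o ∈ s, φ o ^ m o).natDegree ≤ ∑ o ∈ s, m o :=
  (Polynomial.natDegree_prod_le _ _).trans <| Finset.sum_le_sum fun o _ =>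
    (Polynomial.natDegree_pow_le_of_le (m o) (hφ o)).trans (mul_one _).le

lemma coeff_prod_pow {ο R : Type} [CommRing R] (φ : ο → Polynomial R)
    (hφ : ∀ o, (φ o).natDegree ≤ 1) (m : ο → ℕ) (s : Finset ο) :
    (∏ o ∈ s, φ o ^ m o).coeff (∑ o ∈ s, m o) = ∏ o ∈ s, (φ o).coeff 1 ^ m o := by
  classical
  induction s using Finset.induction_on with
  | empty => simp
  | insert a s ha ih =>
    rw [Finset.prod_insert ha, Finset.sum_insert ha, Finset.prod_insert ha,
      Polynomial.coeff_mul_add_eq_of_natDegree_le _ (natDegree_prod_pow_le φ hφ m s), ih]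
    · congr 1
      simpa using Polynomial.coeff_pow_of_natDegree_le (hφ a) (m := m a)
    · exact (Polynomial.natDegree_pow_le_of_le (m a) (hφ a)).trans (mul_one _).le

lemma natDegree_aeval_le {ο K R : Type} [Fintype ο] [Field K] [CommRing R] [Algebra K R]
    (φ : ο → Polynomial R) (hφ : ∀ o, (φ o).natDegree ≤ 1) (f : MvPolynomial ο K) :
    (aeval φ f).natDegree ≤ f.totalDegree := by
  rw [aeval_def, eval₂_eq']
  refine Polynomial.natDegree_sum_le_of_forall_le _ _ fun m hm => ?_
  rw [Polynomial.algebraMap_apply]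
  refine (Polynomial.natDegree_C_mul_le _ _).trans ((natDegree_prod_pow_le φ hφ _ _).trans ?_)
  have := le_totalDegree hm
  rwa [Finsupp.sum_fintype _ _ fun _ => rfl] at this

lemma coeff_aeval_totalDegree {ο K R : Type} [Fintype ο] [Field K] [CommRing R] [Algebra K R]
    (φ : ο → Polynomial R) (hφ : ∀ o, (φ o).natDegree ≤ 1) (f : MvPolynomial ο K) :
    (aeval φ f).coeff f.totalDegree =
      aeval (fun o => (φ o).coeff 1) (homogeneousComponent f.totalDegree f) := by
  conv_lhs => rw [aeval_def, eval₂_eq']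
  rw [homogeneousComponent_apply, map_sum, Polynomial.finsetSum_coeff, Finset.sum_filter]
  refine Finset.sum_congr rfl fun m hm => ?_
  have hle := le_totalDegree hm
  rw [Finsupp.sum_fintype _ _ fun _ => rfl] at hle
  have hd : m.degree = ∑ o, m o := Finsupp.degree_eq_sum m
  rw [Polynomial.algebraMap_apply, Polynomial.coeff_C_mul, hd, aeval_monomial,
    Finsupp.prod_fintype _ _ fun _ => pow_zero _]
  split_ifs with h
  · rw [← h, coeff_prod_pow φ hφ]
  · rw [Polynomial.coeff_eq_zero_of_natDegree_lt, mul_zero]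
    exact (natDegree_prod_pow_le φ hφ _ _).trans_lt (lt_of_le_of_ne hle h)

lemma exists_eval_homogeneousComponent_ne_zero {ι K : Type} [Fintype ι] [Field K] [Algebra ℂ K]
    {f : MvPolynomial (Option ι) K} (hf : f ≠ 0) :
    ∃ c : ι → ℂ, eval (fun o : Option ι => o.elim 1 fun i => algebraMap ℂ K (c i))
      (homogeneousComponent f.totalDegree f) ≠ 0 := by
  set h := homogeneousComponent f.totalDegree f with hh
  have hhom : h.IsHomogeneous f.totalDegree := homogeneousComponent_isHomogeneous _ _
  have hh0 : h ≠ 0 := by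
    obtain ⟨m, hm, hdeg⟩ := Finset.exists_mem_eq_sup f.support (support_nonempty.mpr hf)
      (fun m => m.sum fun _ e => e)
    intro h0
    have := congrArg (coeff m) h0
    rw [hh, coeff_homogeneousComponent, coeff_zero, if_pos] at this
    · exact mem_support_iff.mp hm this
    · rw [totalDegree, hdeg]; rfl
  have hinf : (Set.range (algebraMap ℂ K)).Infinite :=
    Set.infinite_range_of_injective (algebraMap ℂ K).injective
  obtain ⟨a, ha, hne⟩ : ∃ a : Option ι → K, a ∈ Set.pi .univ (fun _ => Set.range (algebraMap ℂ K)) ∧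
      eval a (X none * h) ≠ 0 := by
    by_contra! hcon
    refine mul_ne_zero (X_ne_zero none) hh0 (funext_set _ (fun _ => hinf) fun x hx => ?_)
    rw [hcon x hx, map_zero]
  rw [map_mul, eval_X] at hne
  choose b hb using fun o => ha o (Set.mem_univ o)
  have ha0 := left_ne_zero_of_mul hne
  refine ⟨fun i => b (some i) / b none, fun h0 => right_ne_zero_of_mul hne ?_⟩
  have : a = fun o => a none * (o.elim 1 fun i => algebraMap ℂ K (b (some i) / b none)) := by
    ext o
    cases o with
    | none => simp
    | some i =>
      simp only [Option.elim_some, map_div₀, hb]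
      field_simp
  rw [eval_eq'] at h0 ⊢
  rw [← mul_zero (a none ^ f.totalDegree), ← h0, Finset.mul_sum]
  refine Finset.sum_congr rfl fun m hm => ?_
  have hdeg : ∑ o, m o = f.totalDegree := by
    rw [← Finsupp.degree_eq_sum]
    rw [Finsupp.degree_eq_weight_one]
    exact hhom (mem_support_iff.mp hm)
  rw [← hdeg, ← Finset.prod_pow_eq_pow_sum, mul_left_comm, ← Finset.prod_mul_distrib]
  congr 1
  refine Finset.prod_congr rfl fun o _ => ?_
  conv_lhs => rw [this]
  rw [mul_pow]

/-- The inductive step of Noether normalisation by a linear change of coordinates. -/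
lemma exists_isIntegralElem_aeval_add_smul {ι K A : Type} [Fintype ι] [Field K] [Algebra ℂ K]
    [CommRing A] [Algebra K A] (x : ι → A) (w : A)
    (hdep : ¬ AlgebraicIndependent K fun o : Option ι => o.elim w x) :
    ∃ c : ι → ℂ, (aeval fun i => x i + algebraMap ℂ K (c i) • w :
      MvPolynomial ι K →ₐ[K] A).toRingHom.IsIntegralElem w := by
  rw [algebraicIndependent_iff] at hdep
  push Not at hdep
  obtain ⟨f, hf, hf0⟩ := hdep
  obtain ⟨c, hc⟩ := exists_eval_homogeneousComponent_ne_zero hf0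
  refine ⟨fun i => -c i, ?_⟩
  let φ : Option ι → Polynomial (MvPolynomial ι K) := fun o =>
    o.elim Polynomial.X fun i => Polynomial.C (X i) +
      Polynomial.C (C (algebraMap ℂ K (c i))) * Polynomial.X
  have hφ : ∀ o, (φ o).natDegree ≤ 1 := by
    rintro (_ | i)
    · exact Polynomial.natDegree_X_le
    · simp only [φ, Option.elim_some]
      compute_degree
  set u := eval (fun o : Option ι => o.elim 1 fun i => algebraMap ℂ K (c i))
      (homogeneousComponent f.totalDegree f) with hu
  have hcoef : (aeval φ f).coeff f.totalDegree = C u := by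
    rw [coeff_aeval_totalDegree φ hφ, hu]
    have : (fun o => (φ o).coeff 1) = algebraMap K (MvPolynomial ι K) ∘
        fun o : Option ι => o.elim 1 fun i => algebraMap ℂ K (c i) := by
      ext1 o
      cases o <;> simp [φ, algebraMap_eq]
    rw [this, aeval_algebraMap_apply]
    simp [aeval_eq_eval, algebraMap_eq]
  refine ⟨Polynomial.C (C u⁻¹) * aeval φ f, ?_, ?_⟩
  · refine Polynomial.monic_of_natDegree_le_of_coeff_eq_one f.totalDegree
      ((Polynomial.natDegree_C_mul_le _ _).trans (natDegree_aeval_le φ hφ f)) ?_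
    rw [Polynomial.coeff_C_mul, hcoef, ← map_mul, inv_mul_cancel₀ hc, map_one]
  · rw [Polynomial.eval₂_mul]
    convert mul_zero _
    rw [← hf]
    set ψ := (aeval fun i => x i + algebraMap ℂ K (-c i) • w : MvPolynomial ι K →ₐ[K] A)
    have : (Polynomial.eval₂RingHom ψ.toRingHom w).comp (aeval φ).toRingHom =
        (aeval fun o : Option ι => o.elim w x : MvPolynomial (Option ι) K →ₐ[K] A).toRingHom := by
      refine MvPolynomial.ringHom_ext (fun r => ?_) fun o => ?_
      · simp [Polynomial.algebraMap_apply, algebraMap_eq]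
      · cases o with
        | none => simp [φ]
        | some i =>
          simp [φ, ψ, ← algebraMap_eq, Algebra.smul_def]
    exact congrArg (fun F => F f) this

lemma isIntegralElem_trans {R S A : Type} [CommRing R] [CommRing S] [CommRing A] {f : R →+* A}
    {g : S →+* A} (h : ∀ s, f.IsIntegralElem (g s)) {w : A} (hw : g.IsIntegralElem w) :
    f.IsIntegralElem w := by
  let _ : Algebra R A := f.toAlgebra
  let g' : S →+* integralClosure R A := g.codRestrict (integralClosure R A) h
  obtain ⟨p, hp, hpw⟩ := hw
  refine isIntegral_trans (R := R) (A := integralClosure R A) w ⟨p.map g', hp.map g', ?_⟩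
  rw [Polynomial.eval₂_map]
  exact hpw

lemma isIntegralElem_aeval {R K A σ : Type} [CommRing R] [Field K] [CommRing A] [Algebra K A]
    {f : R →+* A} (hK : ∀ k, f.IsIntegralElem (algebraMap K A k)) {x : σ → A}
    (hx : ∀ i, f.IsIntegralElem (x i)) (p : MvPolynomial σ K) :
    f.IsIntegralElem (aeval x p) := by
  induction p using MvPolynomial.induction_on with
  | C k => simpa using hK k
  | add p q hp hq => simpa using hp.add f hq
  | mul_X p i hp => simpa using hp.mul f (hx i)

lemma isIntegralElem_aeval_algebraMap {K A σ : Type} [Field K] [CommRing A] [Algebra K A]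
    (x : σ → A) (k : K) :
    (aeval x : MvPolynomial σ K →ₐ[K] A).toRingHom.IsIntegralElem (algebraMap K A k) := by
  rw [← (aeval x : MvPolynomial σ K →ₐ[K] A).commutes k]
  exact RingHom.isIntegralElem_map _

lemma isIntegralElem_aeval_apply {K A σ : Type} [Field K] [CommRing A] [Algebra K A]
    (x : σ → A) (i : σ) :
    (aeval x : MvPolynomial σ K →ₐ[K] A).toRingHom.IsIntegralElem (x i) := by
  conv => enter [2]; rw [← aeval_X (R := K) x i]
  exact RingHom.isIntegralElem_map _

/-- Noether normalisation by a linear change of coordinates. -/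
lemma exists_forall_isIntegralElem_aeval_add_sum {ι γ K A : Type} [Fintype ι] [Field K]
    [Algebra ℂ K] [CommRing A] [Algebra K A]
    (hdep : ∀ y : Option ι → A, ¬ AlgebraicIndependent K y) (x : ι → A) (w : γ → A)
    (s : Finset γ) :
    ∃ c : ι → γ → ℂ, ∀ j ∈ s,
      (aeval fun i => x i + ∑ j ∈ s, algebraMap ℂ K (c i j) • w j :
        MvPolynomial ι K →ₐ[K] A).toRingHom.IsIntegralElem (w j) := by
  classical
  induction s using Finset.induction_on with
  | empty => simp
  | insert a s ha ih =>
    obtain ⟨c, hc⟩ := ih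
    obtain ⟨c', hc'⟩ := exists_isIntegralElem_aeval_add_smul
      (fun i => x i + ∑ j ∈ s, algebraMap ℂ K (c i j) • w j) (w a) (hdep _)
    have heq : (fun i => x i + ∑ j ∈ insert a s,
        algebraMap ℂ K (if j = a then c' i else c i j) • w j) =
        fun i => x i + ∑ j ∈ s, algebraMap ℂ K (c i j) • w j + algebraMap ℂ K (c' i) • w a := by
      ext i
      rw [Finset.sum_insert ha, if_pos rfl, add_assoc, add_comm (algebraMap ℂ K (c' i) • w a)]
      congr 2
      refine Finset.sum_congr rfl fun j hj => ?_
      rw [if_neg (ne_of_mem_of_not_mem hj ha)]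
    refine ⟨fun i j => if j = a then c' i else c i j, ?_⟩
    rw [heq]
    set f := (aeval fun i => x i + ∑ j ∈ s, algebraMap ℂ K (c i j) • w j +
      algebraMap ℂ K (c' i) • w a : MvPolynomial ι K →ₐ[K] A).toRingHom with hf
    have hx : ∀ i, f.IsIntegralElem (x i + ∑ j ∈ s, algebraMap ℂ K (c i j) • w j) := fun i => by
      have h1 : f.IsIntegralElem (x i + ∑ j ∈ s, algebraMap ℂ K (c i j) • w j +
          algebraMap ℂ K (c' i) • w a) := isIntegralElem_aeval_apply (K := K) (fun i => x i +
            ∑ j ∈ s, algebraMap ℂ K (c i j) • w j + algebraMap ℂ K (c' i) • w a) i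
      have h2 : f.IsIntegralElem (algebraMap ℂ K (c' i) • w a) := by
        rw [Algebra.smul_def]
        exact (isIntegralElem_aeval_algebraMap _ _).mul f hc'
      simpa using h1.sub f h2
    intro j hj
    rcases Finset.mem_insert.mp hj with rfl | hj
    · exact hc'
    · exact isIntegralElem_trans
        (isIntegralElem_aeval (fun k => isIntegralElem_aeval_algebraMap _ k) hx) (hc j hj)

/-- Elimination coordinates: for a system `g, J` generating the unit ideal, `Option κ` many linear
combinations of `y`, `z * J` and `z * g` over which all polynomials in `y, z` are integral. -/
def elimCoord {κ γ R : Type} [Fintype γ] [CommRing R] [Algebra ℂ R] (g : γ → MvPolynomial κ R)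
    (J : MvPolynomial κ R) (c : Option κ → γ → ℂ) (o : Option κ) : MvPolynomial (Option κ) R :=
  o.elim (X none * rename some J) (fun i => X (some i)) +
    ∑ j, C (algebraMap ℂ R (c o j)) * (X none * rename some (g j))

lemma exists_isIntegralElem_elimCoord {κ γ K : Type} [Fintype κ] [Fintype γ] [Field K]
    [Algebra ℂ K] (g : γ → MvPolynomial κ K) (J : MvPolynomial κ K)
    (h1 : (1 : MvPolynomial κ K) ∈ Ideal.span (insert J (Set.range g))) :
    ∃ c : Option κ → γ → ℂ,
      (aeval (elimCoord g J c) : MvPolynomial (Option κ) K →ₐ[K]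
        MvPolynomial (Option κ) K).toRingHom.IsIntegralElem (X none) ∧
      Function.Injective (aeval (elimCoord g J c) : MvPolynomial (Option κ) K →ₐ[K]
        MvPolynomial (Option κ) K) := by
  have htr : Algebra.trdeg K (MvPolynomial (Option κ) K) = Cardinal.mk (Option κ) := by
    simp [MvPolynomial.trdeg_of_isDomain]
  obtain ⟨c, hc⟩ := exists_forall_isIntegralElem_aeval_add_sum (K := K)
    (A := MvPolynomial (Option κ) K) (ι := Option κ) (γ := γ) (fun y hy => by
      have := hy.cardinalMk_le_trdeg
      rw [htr] at this
      simp only [Cardinal.mk_fintype, Fintype.card_option] at this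
      norm_cast at this
      omega)
    (fun o => o.elim (X none * rename some J) (fun i => X (some i)))
    (fun j => X none * rename some (g j)) Finset.univ
  simp_rw [smul_eq_C_mul] at hc
  refine ⟨c, ?_⟩
  change ∀ j ∈ Finset.univ, (aeval (elimCoord g J c) : MvPolynomial (Option κ) K →ₐ[K]
        MvPolynomial (Option κ) K).toRingHom.IsIntegralElem _ at hc
  set f := (aeval (elimCoord g J c) : MvPolynomial (Option κ) K →ₐ[K]
        MvPolynomial (Option κ) K).toRingHom with hf
  have hK : ∀ k, f.IsIntegralElem (C k) := isIntegralElem_aeval_algebraMap _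
  have hstart : ∀ o : Option κ,
      f.IsIntegralElem (o.elim (X none * rename some J) (fun i => X (some i))) := fun o => by
    have h2 : f.IsIntegralElem (elimCoord g J c o) := isIntegralElem_aeval_apply _ o
    have h3 : f.IsIntegralElem
        (∑ j, C (algebraMap ℂ K (c o j)) * (X none * rename some (g j))) := by
      let _ := f.toAlgebra
      exact IsIntegral.sum _ fun j hj => (hK _).mul f (hc j hj)
    simpa [elimCoord] using h2.sub f h3
  have hy : ∀ p : MvPolynomial κ K, f.IsIntegralElem (rename some p) := fun p => by
    rw [rename_eq_aeval]
    exact isIntegralElem_aeval hK (fun i => hstart (some i)) p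
  have hz : f.IsIntegralElem (X none) := by
    have : ∀ p ∈ Ideal.span (insert J (Set.range g)), f.IsIntegralElem (X none * rename some p) := by
      intro p hp
      induction hp using Submodule.span_induction with
      | mem p hp =>
        rcases hp with rfl | ⟨j, rfl⟩
        · exact hstart none
        · exact hc j (Finset.mem_univ j)
      | zero => simpa using f.isIntegralElem_zero
      | add p q _ _ hp hq => simpa [mul_add] using hp.add f hq
      | smul a p _ hp => simpa [mul_left_comm] using (hy a).mul f hp
    simpa using this 1 h1
  refine ⟨hz, ?_⟩
  have hall : ∀ a : MvPolynomial (Option κ) K, f.IsIntegralElem a := fun a => by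
    have := isIntegralElem_aeval hK (x := X) (f := f) (fun o => by
      cases o with
      | none => exact hz
      | some i => exact hstart (some i)) a
    simpa using this
  have : Algebra.IsAlgebraic (Algebra.adjoin K (Set.range (elimCoord g J c)))
      (MvPolynomial (Option κ) K) := by
    refine ⟨fun a => IsIntegral.isAlgebraic ?_⟩
    obtain ⟨p, hp, hpa⟩ := hall a
    let f' : MvPolynomial (Option κ) K →+* Algebra.adjoin K (Set.range (elimCoord g J c)) :=
      f.codRestrict _ fun s => by
        rw [Algebra.adjoin_range_eq_range_aeval]
        exact ⟨s, rfl⟩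
    refine ⟨p.map f', hp.map f', ?_⟩
    rw [Polynomial.eval₂_map]
    exact hpa
  exact (Algebra.IsAlgebraic.isTranscendenceBasis_of_le_trdeg_of_finite K (elimCoord g J c) htr.ge).1

lemma map_elimCoord {κ γ R R' : Type} [Fintype γ] [CommRing R] [Algebra ℂ R] [CommRing R']
    [Algebra ℂ R'] (φ : R →ₐ[ℂ] R') (g : γ → MvPolynomial κ R) (J : MvPolynomial κ R)
    (c : Option κ → γ → ℂ) (o : Option κ) :
    map φ.toRingHom (elimCoord g J c o) =
      elimCoord (fun j => map φ.toRingHom (g j)) (map φ.toRingHom J) c o := by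
  cases o <;> simp [elimCoord, map_rename]

lemma exists_eval₂_elimCoord_eq_zero {κ γ B : Type} [Fintype κ] [Fintype γ] [CommRing B]
    [IsDomain B] [Algebra ℂ B] (g : γ → MvPolynomial κ B) (J : MvPolynomial κ B) {ξ₀ : B}
    (hξ₀ : ξ₀ ≠ 0) (hmem : C ξ₀ ∈ Ideal.span (insert J (Set.range g))) :
    ∃ c : Option κ → γ → ℂ,
      Function.Injective (aeval (elimCoord g J c) : MvPolynomial (Option κ) B →ₐ[B]
        MvPolynomial (Option κ) B) ∧
      ∃ ξ : B, ξ ≠ 0 ∧ ∃ q : Polynomial (MvPolynomial (Option κ) B), q.leadingCoeff = C ξ ∧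
        q.eval₂ (aeval (elimCoord g J c) : MvPolynomial (Option κ) B →ₐ[B]
          MvPolynomial (Option κ) B).toRingHom (X none) = 0 := by
  obtain ⟨K, _, _, _, _, _⟩ : ∃ (K : Type) (_ : Field K) (_ : Algebra B K) (_ : Algebra ℂ K)
      (_ : IsScalarTower ℂ B K), IsFractionRing B K :=
    ⟨FractionRing B, inferInstance, inferInstance, inferInstance, inferInstance, inferInstance⟩
  let φ : B →ₐ[ℂ] K := IsScalarTower.toAlgHom ℂ B K
  have hφ : Function.Injective φ := IsFractionRing.injective B K
  have hmap : ∀ σ : Type, Function.Injective (map (σ := σ) φ.toRingHom) := fun σ =>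
    map_injective _ hφ
  have h1 : (1 : MvPolynomial κ K) ∈ Ideal.span
      (insert (map φ.toRingHom J) (Set.range fun j => map φ.toRingHom (g j))) := by
    have h := Ideal.mem_map_of_mem (map φ.toRingHom) hmem
    rw [Ideal.map_span, Set.image_insert_eq, ← Set.range_comp, map_C] at h
    have hu : IsUnit (C (σ := κ) (φ.toRingHom ξ₀)) :=
      (IsUnit.mk0 _ ((map_ne_zero_iff _ hφ).mpr hξ₀)).map C
    exact (Ideal.eq_top_iff_one _).mp (Ideal.eq_top_of_isUnit_mem _ h hu)
  obtain ⟨c, ⟨p, hp, hpz⟩, hinj⟩ := exists_isIntegralElem_elimCoord _ _ h1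
  set f := (aeval (elimCoord g J c) : MvPolynomial (Option κ) B →ₐ[B] MvPolynomial (Option κ) B)
  have hcomm : ∀ s, map φ.toRingHom (f s) =
      aeval (elimCoord (fun j => map φ.toRingHom (g j)) (map φ.toRingHom J) c)
        (map φ.toRingHom s) := fun s => by
    simp only [f, aeval_def, map_eval₂Hom, eval₂_map, ← coe_eval₂Hom]
    congr 2
    · ext; simp [algebraMap_eq]
    · ext1 o
      exact map_elimCoord φ g J c o
  refine ⟨c, ?_, ?_⟩
  · refine Function.Injective.of_comp (f := map (σ := Option κ) φ.toRingHom) ?_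
    have : (map (σ := Option κ) φ.toRingHom) ∘ f =
      aeval (elimCoord (fun j => map φ.toRingHom (g j)) (map φ.toRingHom J) c) ∘
        (map (σ := Option κ) φ.toRingHom) := funext hcomm
    rw [this]
    exact hinj.comp (hmap _)
  · let _ : Algebra (MvPolynomial (Option κ) B) (MvPolynomial (Option κ) K) := algebraMvPolynomial
    let M := (nonZeroDivisors B).map (C (σ := Option κ))
    obtain ⟨_, ⟨ξ, hξ, rfl⟩, hb⟩ := IsLocalization.integerNormalization_spec M p
    set q := IsLocalization.integerNormalization M p
    have hb' : q.map (map φ.toRingHom) = Polynomial.C (C (φ ξ)) * p := by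
      rw [← algebraMap_smul (MvPolynomial (Option κ) K), Polynomial.smul_eq_C_mul] at hb
      simp only [algebraMap_def, map_C] at hb
      exact hb
    refine ⟨ξ, nonZeroDivisors.ne_zero hξ, q, hmap _ ?_, hmap _ ?_⟩
    · rw [← Polynomial.leadingCoeff_map_of_injective (hmap _), hb', Polynomial.leadingCoeff_mul,
        hp.leadingCoeff, Polynomial.leadingCoeff_C, mul_one, map_C]
      rfl
    · rw [map_zero, Polynomial.hom_eval₂]
      have : (map φ.toRingHom).comp f.toRingHom =
        (aeval (elimCoord (fun j => map φ.toRingHom (g j)) (map φ.toRingHom J) c)).toRingHom.comp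
          (map φ.toRingHom) := RingHom.ext hcomm
      rw [this, ← Polynomial.eval₂_map, hb', map_X, Polynomial.eval₂_mul, hpz, mul_zero]

/-- The exponent vectors of weighted degree at most `D`. -/
def weightedExponents {ρ : Type} [Fintype ρ] [DecidableEq ρ] (ω : ρ → ℕ) (D : ℕ) :
    Finset (ρ → ℕ) :=
  (Fintype.piFinset fun _ => Finset.range (D + 1)).filter fun a => ∑ r, ω r * a r ≤ D

lemma mem_weightedExponents {ρ : Type} [Fintype ρ] [DecidableEq ρ] {ω : ρ → ℕ}
    (hω : ∀ r, 1 ≤ ω r) {D : ℕ} {a : ρ → ℕ} :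
    a ∈ weightedExponents ω D ↔ ∑ r, ω r * a r ≤ D := by
  simp only [weightedExponents, Finset.mem_filter, Fintype.mem_piFinset, Finset.mem_range,
    and_iff_right_iff_imp]
  intro h r
  have h1 := Finset.single_le_sum (fun r _ => Nat.zero_le (ω r * a r)) (Finset.mem_univ r)
  have h2 := Nat.le_mul_of_pos_left (a r) (hω r)
  omega

lemma card_weightedExponents_one (ρ : Type) [Fintype ρ] [DecidableEq ρ] (D : ℕ) :
    (weightedExponents (fun _ : ρ => 1) D).card = (D + Fintype.card ρ).choose D := by
  have h := Finset.card_finsuppAntidiag_nat_eq_choose (s := (Finset.univ : Finset (Option ρ))) D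
  rw [Finset.card_univ, Fintype.card_option,
    show Fintype.card ρ + 1 + D - 1 = D + Fintype.card ρ by omega] at h
  rw [← h]
  refine Finset.card_bij'
    (fun b _ => Finsupp.equivFunOnFinite.symm fun o => o.elim (D - ∑ r, b r) b)
    (fun a _ r => a (some r)) ?_ ?_ ?_ ?_
  · intro b hb
    rw [mem_weightedExponents fun _ => le_rfl] at hb
    simp only [one_mul] at hb
    simp [Finset.mem_finsuppAntidiag, Fintype.sum_option, hb]
  · intro a ha
    rw [mem_weightedExponents fun _ => le_rfl]
    simp only [Finset.mem_finsuppAntidiag, Fintype.sum_option] at ha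
    simp
    omega
  · intro b hb
    rfl
  · intro a ha
    simp only [Finset.mem_finsuppAntidiag, Fintype.sum_option] at ha
    ext o
    cases o with
    | none => simp; omega
    | some r => simp

lemma card_weightedExponents_one_le {ρ : Type} [Fintype ρ] [DecidableEq ρ] {ω : ρ → ℕ}
    (hω : ∀ r, 1 ≤ ω r) (D : ℕ) :
    (weightedExponents (fun _ : ρ => 1) D).card ≤
      (weightedExponents ω D).card * ∏ r, ω r := by
  have h : (weightedExponents ω D ×ˢ Fintype.piFinset fun r => Finset.range (ω r)).card =
      (weightedExponents ω D).card * ∏ r, ω r := by simp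
  rw [← h]
  refine Finset.card_le_card_of_injOn (fun b => (fun r => b r / ω r, fun r => b r % ω r)) ?_ ?_
  · intro b hb
    rw [Finset.mem_coe, mem_weightedExponents fun _ => le_rfl] at hb
    simp only [one_mul] at hb
    simp only [Finset.coe_product, Set.mem_prod, Finset.mem_coe, mem_weightedExponents hω,
      Fintype.mem_piFinset, Finset.mem_range]
    exact ⟨(Finset.sum_le_sum fun r _ => Nat.mul_div_le _ _).trans hb,
      fun r => Nat.mod_lt _ (hω r)⟩
  · intro b _ b' _ h
    simp only [Prod.mk.injEq] at h
    ext r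
    rw [← Nat.div_add_mod (b r) (ω r), ← Nat.div_add_mod (b' r) (ω r), congrFun h.1 r,
      congrFun h.2 r]

lemma card_weightedExponents_lt {σ ρ : Type} [Fintype σ] [Fintype ρ] [DecidableEq σ]
    [DecidableEq ρ] (hcard : Fintype.card ρ = Fintype.card σ + 1) {ω : ρ → ℕ}
    (hω : ∀ r, 1 ≤ ω r) {D : ℕ} (hD : Fintype.card ρ * ∏ r, ω r ≤ D) :
    (weightedExponents (fun _ : σ => 1) D).card < (weightedExponents ω D).card := by
  have h1 := card_weightedExponents_one_le hω D
  rw [card_weightedExponents_one, hcard] at h1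
  rw [card_weightedExponents_one]
  set M := Fintype.card σ
  set A := (weightedExponents ω D).card
  set W := ∏ r, ω r
  have h2 := Nat.add_one_mul_choose_eq (D + M) M
  rw [← Nat.choose_symm_add, add_assoc] at h2
  have h3 : (D + (M + 1)).choose (M + 1) = (D + (M + 1)).choose D := (Nat.choose_symm_add ..).symm
  rw [h3] at h2
  have hpos : 0 < (D + M).choose D := Nat.choose_pos (by omega)
  by_contra! hle
  rw [hcard] at hD
  have h4 : (D + (M + 1)) * (D + M).choose D ≤ D * (D + M).choose D := by
    calc _ = (D + (M + 1)).choose D * (M + 1) := h2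
      _ ≤ A * W * (M + 1) := by gcongr
      _ ≤ (D + M).choose D * W * (M + 1) := by gcongr
      _ = ((M + 1) * W) * (D + M).choose D := by ring
      _ ≤ _ := by gcongr
  have := Nat.le_of_mul_le_mul_right h4 hpos
  omega

/-- A quantitative form of the fact that `n + 1` polynomials in `n` variables are algebraically
dependent. -/
lemma exists_aeval_eq_zero_totalDegree_le {σ ρ : Type} [Fintype σ] [Fintype ρ]
    (hcard : Fintype.card ρ = Fintype.card σ + 1) (Φ : ρ → MvPolynomial σ ℂ) {ω : ρ → ℕ}
    (hω : ∀ r, 1 ≤ ω r) (hΦ : ∀ r, (Φ r).totalDegree ≤ ω r) {D : ℕ}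
    (hD : Fintype.card ρ * ∏ r, ω r ≤ D) :
    ∃ Q : MvPolynomial ρ ℂ, Q ≠ 0 ∧ aeval Φ Q = 0 ∧ Q.totalDegree ≤ D := by
  classical
  let A := weightedExponents ω D
  let B := weightedExponents (fun _ : σ => 1) D
  let T : (A → ℂ) →ₗ[ℂ] (B → ℂ) :=
    { toFun := fun c b => ∑ a : A, c a *
        coeff (Finsupp.equivFunOnFinite.symm b.1) (∏ r, Φ r ^ a.1 r)
      map_add' := fun c c' => by ext; simp [add_mul, Finset.sum_add_distrib]
      map_smul' := fun s c => by ext; simp [Finset.mul_sum, mul_assoc] }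
  have hT : LinearMap.ker T ≠ ⊥ := by
    apply LinearMap.ker_ne_bot_of_finrank_lt
    simpa using card_weightedExponents_lt hcard hω hD
  obtain ⟨c, hc, hc0⟩ := Submodule.exists_mem_ne_zero_of_ne_bot hT
  let Q : MvPolynomial ρ ℂ := ∑ a : A, monomial (Finsupp.equivFunOnFinite.symm a.1) (c a)
  have hcoeff : ∀ a : A, coeff (Finsupp.equivFunOnFinite.symm a.1) Q = c a := fun a => by
    simp only [Q, coeff_sum, coeff_monomial, EmbeddingLike.apply_eq_iff_eq]
    simp
  refine ⟨Q, ?_, ?_, ?_⟩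
  · intro h
    refine hc0 (funext fun a => ?_)
    rw [← hcoeff, h, coeff_zero]; rfl
  · have haev : aeval Φ Q = ∑ a : A, C (c a) * ∏ r, Φ r ^ a.1 r := by
      rw [map_sum]
      refine Finset.sum_congr rfl fun a _ => ?_
      rw [aeval_monomial, algebraMap_eq, Finsupp.prod_fintype _ _ fun _ => pow_zero _]
      rfl
    have hdeg : (aeval Φ Q).totalDegree ≤ D := by
      rw [haev]
      refine totalDegree_finsetSum_le fun a _ => ?_
      refine (totalDegree_mul _ _).trans ?_
      rw [totalDegree_C, zero_add]
      refine (totalDegree_finsetProd _ _).trans (le_trans ?_ ((mem_weightedExponents hω).mp a.2))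
      refine Finset.sum_le_sum fun r _ => (totalDegree_pow _ _).trans ?_
      rw [mul_comm]
      exact Nat.mul_le_mul_right _ (hΦ r)
    ext b
    by_cases hb : ⇑b ∈ B
    · have := congrFun (LinearMap.mem_ker.mp hc) ⟨b, hb⟩
      rw [haev, coeff_sum, coeff_zero]
      simpa [T] using this
    · rw [coeff_zero]
      by_contra hne
      refine hb ((mem_weightedExponents fun _ => le_rfl).mpr ?_)
      have := le_totalDegree (mem_support_iff.mpr hne)
      rw [Finsupp.sum_fintype _ _ fun _ => rfl] at this
      simpa using this.trans hdeg
  · refine totalDegree_finsetSum_le fun a _ => (totalDegree_monomial_le _ _).trans ?_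
    rw [Finsupp.sum_fintype _ _ fun _ => rfl]
    refine le_trans (Finset.sum_le_sum fun r _ => ?_) ((mem_weightedExponents hω).mp a.2)
    exact Nat.le_mul_of_pos_left _ (hω r)

/-- An irreducible polynomial divides every polynomial with which it shares a root. -/
lemma dvd_of_irreducible_of_eval₂_eq_zero {R A : Type} [CommRing R] [IsDomain R]
    [UniqueFactorizationMonoid R] [CommRing A] [IsDomain A] {φ : R →+* A}
    (hφ : Function.Injective φ) (z : A) {P q : Polynomial R} (hP : Irreducible P)
    (hPz : P.eval₂ φ z = 0) (hqz : q.eval₂ φ z = 0) : P ∣ q := by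
  have hdeg : P.natDegree ≠ 0 := by
    intro h
    rw [Polynomial.eq_C_of_natDegree_eq_zero h, Polynomial.eval₂_C, map_eq_zero_iff _ hφ] at hPz
    rw [Polynomial.eq_C_of_natDegree_eq_zero h, hPz, map_zero] at hP
    exact hP.ne_zero rfl
  have : IsGCDMonoid R := ⟨UniqueFactorizationMonoid.toGCDMonoid R⟩
  have hprim : P.IsPrimitive := hP.isPrimitive hdeg
  obtain ⟨K, _, _, _⟩ : ∃ (K : Type) (_ : Field K) (_ : Algebra R K), IsFractionRing R K :=
    ⟨FractionRing R, inferInstance, inferInstance, inferInstance⟩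
  obtain ⟨E, _, _, _⟩ : ∃ (E : Type) (_ : Field E) (_ : Algebra A E), IsFractionRing A E :=
    ⟨FractionRing A, inferInstance, inferInstance, inferInstance⟩
  have hinj : Function.Injective ((algebraMap A E).comp φ) :=
    (IsFractionRing.injective A E).comp hφ
  let ψ : K →+* E := IsFractionRing.lift hinj
  have hψ : ∀ f : Polynomial R, (f.map (algebraMap R K)).eval₂ ψ (algebraMap A E z) =
      algebraMap A E (f.eval₂ φ z) := fun f => by
    rw [Polynomial.eval₂_map, Polynomial.hom_eval₂]
    congr 1
    ext r
    exact IsFractionRing.lift_algebraMap hinj r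
  have hirr := (hprim.irreducible_iff_irreducible_map_fraction_map (K := K)).mp hP
  refine hprim.dvd_of_fraction_map_dvd_fraction_map (K := K) ?_
  by_contra hnd
  obtain ⟨a, b, hab⟩ := (EuclideanDomain.dvd_or_coprime _ _ hirr).resolve_left hnd
  have h := congrArg (Polynomial.eval₂ ψ (algebraMap A E z)) hab
  simp [Polynomial.eval₂_add, Polynomial.eval₂_mul, hψ, hPz, hqz] at h

/-- If `z` satisfies a polynomial relation of degree at most `D` over the algebraically independent
family `θ`, then it satisfies one whose leading coefficient has degree at most `D` and divides the
leading coefficient of any other given relation. -/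
lemma exists_eval₂_eq_zero_leadingCoeff_dvd {τ A : Type} [CommRing A] [IsDomain A] [Algebra ℂ A]
    {θ : τ → A} (hθ : Function.Injective (aeval θ : MvPolynomial τ ℂ →ₐ[ℂ] A)) {z : A} {D : ℕ}
    {Q : MvPolynomial (Option τ) ℂ} (hQ0 : Q ≠ 0)
    (hQ : aeval (fun o : Option τ => o.elim z θ) Q = 0) (hQD : Q.totalDegree ≤ D)
    {q : Polynomial (MvPolynomial τ ℂ)}
    (hq : q.eval₂ (aeval θ : MvPolynomial τ ℂ →ₐ[ℂ] A).toRingHom z = 0) :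
    ∃ P : Polynomial (MvPolynomial τ ℂ), P ≠ 0 ∧
      P.eval₂ (aeval θ : MvPolynomial τ ℂ →ₐ[ℂ] A).toRingHom z = 0 ∧
      P.leadingCoeff ∣ q.leadingCoeff ∧ P.leadingCoeff.totalDegree ≤ D := by
  let N : MvPolynomial (Option τ) ℂ →ₐ[ℂ] A := aeval fun o : Option τ => o.elim z θ
  obtain ⟨P, hPQ, hPN⟩ : ∃ P ∈ UniqueFactorizationMonoid.factors Q, P ∈ RingHom.ker N := by
    refine ((RingHom.ker_isPrime N).multiset_prod_mem_iff_exists_mem _).mp ?_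
    obtain ⟨u, hu⟩ := UniqueFactorizationMonoid.factors_prod hQ0
    have : N ((UniqueFactorizationMonoid.factors Q).prod) * N u = 0 := by rw [← map_mul, hu]; exact hQ
    exact (mul_eq_zero.mp this).resolve_right ((u.isUnit.map N).ne_zero)
  have hPirr := UniqueFactorizationMonoid.irreducible_of_factor P hPQ
  obtain ⟨R, hR⟩ := UniqueFactorizationMonoid.dvd_of_mem_factors hPQ
  have hPD : P.totalDegree ≤ D := by
    refine le_trans ?_ hQD
    rw [hR] at hQ0 ⊢
    rw [totalDegree_mul_of_isDomain (left_ne_zero_of_mul hQ0) (right_ne_zero_of_mul hQ0)]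
    exact Nat.le_add_right _ _
  let P' := optionEquivLeft ℂ τ P
  have hP'irr : Irreducible P' := (MulEquiv.irreducible_iff (optionEquivLeft ℂ τ)).mpr hPirr
  have hNe : (N : _ →+* A) =
      (Polynomial.eval₂RingHom (aeval θ : MvPolynomial τ ℂ →ₐ[ℂ] A).toRingHom z).comp
        (optionEquivLeft ℂ τ).toRingEquiv.toRingHom := by
    refine MvPolynomial.ringHom_ext (fun c => ?_) fun o => ?_
    · simp [N, optionEquivLeft_C]
    · cases o <;> simp [N, optionEquivLeft_X_none, optionEquivLeft_X_some]
  have hP'z : P'.eval₂ (aeval θ : MvPolynomial τ ℂ →ₐ[ℂ] A).toRingHom z = 0 := by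
    have : (N : _ →+* A) P = 0 := hPN
    rw [hNe] at this
    exact this
  refine ⟨P', hP'irr.ne_zero, hP'z, ?_, ?_⟩
  · obtain ⟨r, hr⟩ := dvd_of_irreducible_of_eval₂_eq_zero hθ z hP'irr hP'z hq
    rw [hr, Polynomial.leadingCoeff_mul]
    exact dvd_mul_right _ _
  · exact (totalDegree_coeff_optionEquivLeft_le _ _ _ _).trans hPD

lemma totalDegree_rename_of_injective {σ τ : Type} {f : σ → τ} (hf : Function.Injective f)
    (P : MvPolynomial σ ℂ) : (rename f P).totalDegree = P.totalDegree := by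
  refine le_antisymm (totalDegree_rename_le f P) ?_
  refine Finset.sup_le fun s hs => ?_
  have h : s.mapDomain f ∈ (rename f P).support := by
    rw [mem_support_iff, coeff_rename_mapDomain f hf]
    exact mem_support_iff.mp hs
  have h' := le_totalDegree h
  rwa [Finsupp.sum_mapDomain_index (fun _ => rfl) fun _ _ _ => rfl] at h'

lemma sumAlgEquiv_rename_map_some {κ ι : Type} (f : MvPolynomial (κ ⊕ ι) ℂ) :
    sumAlgEquiv ℂ (Option κ) ι (rename (Sum.map some id) f) =
      rename some (sumAlgEquiv ℂ κ ι f) := by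
  induction f using MvPolynomial.induction_on with
  | C c => simp
  | add p q hp hq => simp [hp, hq]
  | mul_X p a hp => cases a <;> simp [hp]

lemma sumAlgEquiv_rename_inr {κ ι : Type} (f : MvPolynomial ι ℂ) :
    sumAlgEquiv ℂ κ ι (rename Sum.inr f) = C f := by
  induction f using MvPolynomial.induction_on with
  | C c => simp
  | add p q hp hq => simp [hp, hq]
  | mul_X p a hp => simp [hp]

/-- The elimination coordinates together with the parameters. -/
def paramElimCoord {κ γ ι : Type} [Fintype γ] (g : γ → MvPolynomial (κ ⊕ ι) ℂ)
    (J : MvPolynomial (κ ⊕ ι) ℂ) (c : Option κ → γ → ℂ) :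
    Option κ ⊕ ι → MvPolynomial (Option κ) (MvPolynomial ι ℂ) :=
  Sum.elim (elimCoord (fun j => sumAlgEquiv ℂ κ ι (g j)) (sumAlgEquiv ℂ κ ι J) c) fun t => C (X t)

lemma aeval_paramElimCoord {κ γ ι : Type} [Fintype γ] (g : γ → MvPolynomial (κ ⊕ ι) ℂ)
    (J : MvPolynomial (κ ⊕ ι) ℂ) (c : Option κ → γ → ℂ) (f : MvPolynomial (Option κ ⊕ ι) ℂ) :
    aeval (paramElimCoord g J c) f =
      aeval (elimCoord (fun j => sumAlgEquiv ℂ κ ι (g j)) (sumAlgEquiv ℂ κ ι J) c)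
        (sumAlgEquiv ℂ (Option κ) ι f) := by
  induction f using MvPolynomial.induction_on with
  | C c => simp [algebraMap_eq, MvPolynomial.algebraMap_apply]
  | add p q hp hq => simp [hp, hq]
  | mul_X p a hp =>
    rw [map_mul, map_mul, map_mul, hp]
    congr 1
    cases a <;> simp [paramElimCoord, algebraMap_eq]

lemma totalDegree_symm_elimCoord_le {κ γ ι : Type} [Fintype γ] (g : γ → MvPolynomial (κ ⊕ ι) ℂ)
    (J : MvPolynomial (κ ⊕ ι) ℂ) (c : Option κ → γ → ℂ) {d e : ℕ} (hde : d ≤ e)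
    (hg : ∀ j, (g j).totalDegree ≤ d) (hJ : J.totalDegree ≤ e) (o : Option κ) :
    ((sumAlgEquiv ℂ (Option κ) ι).symm (elimCoord (fun j => sumAlgEquiv ℂ κ ι (g j))
      (sumAlgEquiv ℂ κ ι J) c o)).totalDegree ≤ o.elim (e + 1) fun _ => d + 1 := by
  have key : ∀ f : MvPolynomial (κ ⊕ ι) ℂ, (sumAlgEquiv ℂ (Option κ) ι).symm
      (X none * rename some (sumAlgEquiv ℂ κ ι f)) =
      X (Sum.inl none) * rename (Sum.map some id) f := fun f => by
    rw [← sumAlgEquiv_rename_map_some, map_mul, AlgEquiv.symm_apply_apply, sumAlgEquiv_symm_X]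
  have hdeg : ∀ (f : MvPolynomial (κ ⊕ ι) ℂ) (m : ℕ), f.totalDegree ≤ m →
      (X (Sum.inl none) * rename (Sum.map some id) f :
        MvPolynomial (Option κ ⊕ ι) ℂ).totalDegree ≤ m + 1 := fun f m hm => by
    refine (totalDegree_mul _ _).trans ?_
    rw [totalDegree_X, add_comm]
    gcongr
    exact (totalDegree_rename_le _ _).trans hm
  have hsum : ((sumAlgEquiv ℂ (Option κ) ι).symm (∑ j, C (algebraMap ℂ _ (c o j)) *
      (X none * rename some (sumAlgEquiv ℂ κ ι (g j))))).totalDegree ≤ d + 1 := by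
    rw [map_sum]
    refine totalDegree_finsetSum_le fun j _ => ?_
    rw [map_mul, key, algebraMap_eq, sumAlgEquiv_symm_C_C]
    refine (totalDegree_mul _ _).trans ?_
    rw [totalDegree_C, zero_add]
    exact hdeg _ _ (hg j)
  rw [elimCoord, map_add]
  refine (totalDegree_add _ _).trans (max_le ?_ (hsum.trans ?_))
  · cases o with
    | none => simpa only [Option.elim_none, key] using hdeg _ _ hJ
    | some i => simp [totalDegree_X]
  · cases o <;> simp [hde]

/-- Quantitative elimination: if a polynomial in the parameters `ι` lies in the ideal of a system
`g, J`, then some such polynomial of controlled degree vanishes on the projection of the zero set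
of the system. -/
lemma exists_elimination_totalDegree_le {κ γ ι : Type} [Fintype κ] [Fintype γ] [Fintype ι]
    (g : γ → MvPolynomial (κ ⊕ ι) ℂ) (J : MvPolynomial (κ ⊕ ι) ℂ) {d e : ℕ} (hde : d ≤ e)
    (hg : ∀ j, (g j).totalDegree ≤ d) (hJ : J.totalDegree ≤ e) {ξ₀ : MvPolynomial ι ℂ}
    (hξ₀ : ξ₀ ≠ 0) (hmem : rename Sum.inr ξ₀ ∈ Ideal.span (insert J (Set.range g))) :
    ∃ Ξ : MvPolynomial ι ℂ, Ξ ≠ 0 ∧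
      Ξ.totalDegree ≤
        (Fintype.card κ + Fintype.card ι + 2) * ((d + 1) ^ Fintype.card κ * (e + 1)) ∧
      ∀ y : κ ⊕ ι → ℂ, (∀ j, eval y (g j) = 0) → eval y J = 0 → eval (y ∘ Sum.inr) Ξ = 0 := by
  let E := sumAlgEquiv ℂ κ ι
  let E' := sumAlgEquiv ℂ (Option κ) ι
  have hmem' : C ξ₀ ∈ Ideal.span (insert (E J) (Set.range fun j => E (g j))) := by
    have h := Ideal.mem_map_of_mem E hmem
    rwa [Ideal.map_span, Set.image_insert_eq, ← Set.range_comp, sumAlgEquiv_rename_inr] at h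
  obtain ⟨c, hinj, ξ, hξ, q, hqlc, hqz⟩ := exists_eval₂_elimCoord_eq_zero _ _ hξ₀ hmem'
  let θ := paramElimCoord g J c
  let z : MvPolynomial (Option κ) (MvPolynomial ι ℂ) := X none
  have hθ : Function.Injective (aeval θ : MvPolynomial (Option κ ⊕ ι) ℂ →ₐ[ℂ] _) := by
    have : ⇑(aeval θ : MvPolynomial (Option κ ⊕ ι) ℂ →ₐ[ℂ] _) = _ ∘ E' :=
      funext (aeval_paramElimCoord g J c)
    rw [this]
    exact hinj.comp E'.injective
  obtain ⟨Q, hQ0, hQ, hQD⟩ := exists_aeval_eq_zero_totalDegree_le (σ := Option κ ⊕ ι)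
    (ρ := Option (Option κ ⊕ ι)) (by simp) (fun o => E'.symm (o.elim z θ))
    (ω := fun o => o.elim 1 (Sum.elim (fun o => o.elim (e + 1) fun _ => d + 1) fun _ => 1))
    (by rintro (_ | (_ | _) | _) <;> simp)
    (by
      rintro (_ | o | _)
      · simp [z, E', totalDegree_X]
      · exact totalDegree_symm_elimCoord_le g J c hde hg hJ o
      · simp [θ, E', totalDegree_X, paramElimCoord])
    le_rfl
  have hQz : aeval (fun o : Option (Option κ ⊕ ι) => o.elim z θ) Q = 0 := by
    have h := congrArg E'.toAlgHom hQ
    rw [map_zero, comp_aeval_apply] at h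
    simpa using h
  obtain ⟨P, hP0, hPz, hPdvd, hPD⟩ := exists_eval₂_eq_zero_leadingCoeff_dvd hθ hQ0 hQz hQD
    (q := q.map (E'.symm : _ →+* MvPolynomial (Option κ ⊕ ι) ℂ)) (by
      rw [Polynomial.eval₂_map, ← hqz]
      congr 1
      refine RingHom.ext fun s => ?_
      exact (aeval_paramElimCoord g J c _).trans (congrArg _ (E'.apply_symm_apply s)))
  rw [Polynomial.leadingCoeff_map_of_injective E'.symm.injective, hqlc] at hPdvd
  obtain ⟨Ξ, hΞξ, hΞ⟩ : ∃ Ξ, Ξ ∣ ξ ∧ E' P.leadingCoeff = C Ξ := by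
    rw [← dvd_C_iff_exists hξ]
    have h := map_dvd E' hPdvd
    simpa using h
  have hΞ' : P.leadingCoeff = rename Sum.inr Ξ := by
    apply E'.injective
    rw [hΞ, sumAlgEquiv_rename_inr]
  refine ⟨Ξ, ne_zero_of_dvd_ne_zero hξ hΞξ, ?_, fun y hgy hJy => ?_⟩
  · rw [← totalDegree_rename_of_injective (Sum.inr_injective (α := Option κ)), ← hΞ']
    refine hPD.trans (le_of_eq ?_)
    simp [Fintype.prod_option]
    ring
  · let χ : MvPolynomial (Option κ) (MvPolynomial ι ℂ) →+* Polynomial ℂ :=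
      eval₂Hom (Polynomial.C.comp (eval (y ∘ Sum.inr)))
        fun o => o.elim Polynomial.X fun i => Polynomial.C (y (Sum.inl i))
    let pt : Option κ ⊕ ι → ℂ :=
      Sum.elim (fun o => o.elim 0 fun i => y (Sum.inl i)) fun t => y (Sum.inr t)
    have hχ : ∀ f : MvPolynomial (κ ⊕ ι) ℂ, χ (rename some (sumAlgEquiv ℂ κ ι f)) =
        Polynomial.C (eval y f) := by
      intro f
      induction f using MvPolynomial.induction_on with
      | C c => simp [χ]
      | add p q hp hq => simp [hp, hq]
      | mul_X p a hp =>
        rw [map_mul, map_mul, map_mul, hp]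
        cases a <;> simp [χ]
    have hcomp : χ.comp (aeval θ : MvPolynomial (Option κ ⊕ ι) ℂ →ₐ[ℂ] _).toRingHom =
        Polynomial.C.comp (eval pt) := by
      refine MvPolynomial.ringHom_ext (fun r => ?_) fun a => ?_
      · simp [χ, MvPolynomial.algebraMap_apply, algebraMap_eq]
      · rcases a with (_ | i) | t
        · simp [θ, paramElimCoord, elimCoord, pt, hχ, hgy, hJy]
        · simp [θ, paramElimCoord, elimCoord, pt, hχ, hgy]
          simp [χ]
        · simp [θ, paramElimCoord, χ, pt]
    have h := congrArg χ hPz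
    rw [map_zero, Polynomial.hom_eval₂, hcomp, ← Polynomial.eval₂_map] at h
    have hX : χ z = Polynomial.X := by simp [χ, z]
    rw [hX, Polynomial.eval₂_C_X] at h
    have h' := congrArg (fun r => r.coeff P.natDegree) h
    simp only [Polynomial.coeff_map, Polynomial.coeff_zero] at h'
    change eval pt P.leadingCoeff = 0 at h'
    rw [hΞ', eval_rename] at h'
    exact h'

lemma totalDegree_pderiv_le {σ : Type} (k : σ) (f : MvPolynomial σ ℂ) :
    (pderiv k f).totalDegree ≤ f.totalDegree - 1 := by
  conv_lhs => rw [f.as_sum, map_sum]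
  refine totalDegree_finsetSum_le fun s hs => ?_
  rw [pderiv_monomial]
  by_cases hk : s k = 0
  · simp [hk]
  · refine (totalDegree_monomial_le _ _).trans ?_
    have h := le_totalDegree hs
    have hsum : s = (s - Finsupp.single k 1) + Finsupp.single k 1 :=
      (tsub_add_cancel_of_le (Finsupp.single_le_iff.mpr (by omega))).symm
    rw [hsum, Finsupp.sum_add_index' (fun _ => rfl) fun _ _ _ => rfl] at h
    simp only [Finsupp.sum_single_index] at h
    exact Nat.le_sub_one_of_lt (Nat.lt_of_succ_le h)

lemma totalDegree_paramJacobian_le {v γ ι : Type} [Fintype γ] [Fintype ι] [DecidableEq γ]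
    [DecidableEq ι] (S : ι → v) (g : γ → MvPolynomial v ℂ) (e : ι ⊕ γ ≃ v) {d : ℕ}
    (hg : ∀ j, (g j).totalDegree ≤ d) :
    (paramJacobian S g e).totalDegree ≤ Fintype.card γ * (d - 1) := by
  rw [paramJacobian, ← Matrix.det_transpose, Matrix.det_apply]
  refine totalDegree_finsetSum_le fun s _ => (totalDegree_smul_le _ _).trans ?_
  refine (totalDegree_finsetProd _ _).trans ?_
  rw [Fintype.sum_sum_type]
  have h1 : ∀ t, (pderiv (e (s (Sum.inl t))) (X (S t) : MvPolynomial v ℂ)).totalDegree = 0 :=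
    fun t => Nat.le_zero.mp ((totalDegree_pderiv_le _ _).trans (by simp [totalDegree_X]))
  have h2 : ∀ j, (pderiv (e (s (Sum.inr j))) (g j)).totalDegree ≤ d - 1 := fun j =>
    (totalDegree_pderiv_le _ _).trans (Nat.sub_le_sub_right (hg j) 1)
  simp only [Matrix.transpose_apply, Matrix.of_apply, Sum.elim_inl, Sum.elim_inr, h1,
    Finset.sum_const_zero, zero_add]
  exact (Finset.sum_le_sum fun j _ => h2 j).trans (by simp)

lemma exists_elimination_of_injective {v γ ι : Type} [Fintype v] [Fintype γ] [Fintype ι]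
    {S : ι → v} (hS : Function.Injective S)
    (hcard : Fintype.card ι + Fintype.card γ = Fintype.card v)
    (g : γ → MvPolynomial v ℂ) (J : MvPolynomial v ℂ) {d e : ℕ} (hde : d ≤ e)
    (hg : ∀ j, (g j).totalDegree ≤ d) (hJ : J.totalDegree ≤ e) {ξ₀ : MvPolynomial ι ℂ}
    (hξ₀ : ξ₀ ≠ 0) (hmem : rename S ξ₀ ∈ Ideal.span (insert J (Set.range g))) :
    ∃ Ξ : MvPolynomial ι ℂ, Ξ ≠ 0 ∧
      Ξ.totalDegree ≤ (Fintype.card v + 2) * ((d + 1) ^ Fintype.card γ * (e + 1)) ∧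
      ∀ y : v → ℂ, (∀ j, eval y (g j) = 0) → eval y J = 0 → eval (y ∘ S) Ξ = 0 := by
  classical
  let κ : Type := ((Set.range S)ᶜ : Set v)
  let w : κ ⊕ ι ≃ v := (Equiv.sumComm _ _).trans
    (((Equiv.ofInjective S hS).sumCongr (Equiv.refl _)).trans (Equiv.Set.sumCompl (Set.range S)))
  have hw : w ∘ Sum.inr = S := rfl
  have hw' : w.symm ∘ S = Sum.inr := by rw [← hw, ← Function.comp_assoc]; simp
  have hκv : Fintype.card κ + Fintype.card ι = Fintype.card v := by
    rw [← Fintype.card_sum, Fintype.card_congr w]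
  have hκ : Fintype.card κ = Fintype.card γ := by omega
  obtain ⟨Ξ, hΞ0, hΞd, hΞ⟩ := exists_elimination_totalDegree_le
    (fun j => rename w.symm (g j)) (rename w.symm J) hde
    (fun j => (totalDegree_rename_le _ _).trans (hg j)) ((totalDegree_rename_le _ _).trans hJ) hξ₀
    (by
      have h := Ideal.mem_map_of_mem (rename w.symm) hmem
      rwa [Ideal.map_span, Set.image_insert_eq, ← Set.range_comp, rename_rename, hw'] at h)
  refine ⟨Ξ, hΞ0, by rwa [hκv, hκ] at hΞd, fun y hgy hJy => ?_⟩
  have h := hΞ (y ∘ w) (fun j => ?_) ?_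
  · rwa [Function.comp_assoc, hw] at h
  · rw [eval_rename, Function.comp_assoc]; simpa using hgy j
  · rw [eval_rename, Function.comp_assoc]; simpa using hJy

/-- A quantitative Sard theorem for the projection onto the coordinates `S`. -/
lemma exists_critical_value_polynomial {v γ ι : Type} [Fintype v] [Fintype γ] [Fintype ι]
    {S : ι → v} (hS : Function.Injective S)
    (hcard : Fintype.card ι + Fintype.card γ = Fintype.card v) (hγ : 0 < Fintype.card γ)
    (g : γ → MvPolynomial v ℂ) {d : ℕ} (hd : 0 < d) (hg : ∀ j, (g j).totalDegree ≤ d) (t₀ : ι)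
    (hreg : ∀ y : v → ℂ, (∀ j, eval y (g j) = 0) → y (S t₀) ≠ 0 →
      ∀ b : γ → ℂ, (∀ k, ∑ j, b j * eval y (pderiv k (g j)) = 0) → b = 0) :
    ∃ Ξ : MvPolynomial ι ℂ, Ξ ≠ 0 ∧
      Ξ.totalDegree ≤ (Fintype.card v + 2) *
        ((d + 1) ^ Fintype.card γ * (Fintype.card γ * (d - 1) + 2)) ∧
      ∀ y : v → ℂ, (∀ j, eval y (g j) = 0) → ∀ w : ι ⊕ γ → ℂ, w ≠ 0 →
        (∀ k, ∑ a, w a * eval y (pderiv k (Sum.elim (fun t => X (S t)) g a)) = 0) →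
        eval (y ∘ S) Ξ = 0 := by
  classical
  let e : ι ⊕ γ ≃ v := Fintype.equivOfCardEq (by rw [Fintype.card_sum, hcard])
  obtain ⟨ξ₀, hξ₀, hmem⟩ := exists_rename_mem_span_paramJacobian S g e t₀ hreg
  have hde : d ≤ Fintype.card γ * (d - 1) + 1 := by
    have := Nat.le_mul_of_pos_left (d - 1) hγ
    omega
  obtain ⟨Ξ, hΞ0, hΞd, hΞ⟩ := exists_elimination_of_injective hS hcard g (paramJacobian S g e)
    hde hg ((totalDegree_paramJacobian_le S g e hg).trans (Nat.le_succ _)) hξ₀ hmem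
  refine ⟨Ξ, hΞ0, hΞd, fun y hgy w hw0 hw => hΞ y hgy ?_⟩
  rw [paramJacobian, RingHom.map_det]
  refine Matrix.exists_vecMul_eq_zero_iff.mp ⟨w, hw0, funext fun b => ?_⟩
  simpa [Matrix.vecMul, dotProduct] using hw (e b)

/-- A nonzero polynomial in `α` and one more variable has a nonzero coefficient with respect to
this variable, which vanishes wherever the polynomial vanishes identically. -/
lemma exists_coeff_vanishing {α : Type} {Ξ : MvPolynomial (Option α) ℂ} (hΞ : Ξ ≠ 0) :
    ∃ Ξ' : MvPolynomial α ℂ, Ξ' ≠ 0 ∧ Ξ'.totalDegree ≤ Ξ.totalDegree ∧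
      ∀ σ : α → ℂ, (∀ c ≠ 0, eval (fun o : Option α => o.elim c σ) Ξ = 0) → eval σ Ξ' = 0 := by
  let P := optionEquivLeft ℂ α Ξ
  have hP : P ≠ 0 := by simpa [P] using hΞ
  refine ⟨P.leadingCoeff, Polynomial.leadingCoeff_ne_zero.mpr hP, ?_, fun σ hσ => ?_⟩
  · exact totalDegree_coeff_optionEquivLeft_le ℂ α Ξ P.natDegree
  · have hz : P.map (eval σ) = 0 := by
      refine Polynomial.eq_zero_of_infinite_isRoot _ (Set.Infinite.mono (s := {0}ᶜ) ?_ ?_)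
      · intro c hc
        rw [Set.mem_ofPred_eq, Polynomial.IsRoot, ← optionEquivLeft_elim_eval]
        exact hσ c hc
      · exact (Set.finite_singleton (0 : ℂ)).infinite_compl
    have h := congrArg (fun r => r.coeff P.natDegree) hz
    simpa [Polynomial.coeff_map] using h

lemma mul_three_pow_le_four_pow (m : ℕ) :
    (m + 1) * (2 * m + 5) * (2 * m + 3) * 3 ^ (2 * m + 1) ≤ 64 * 4 ^ (2 * m + 1) := by
  rcases le_total m 4 with h | h
  · interval_cases m <;> norm_num
  · induction m, h using Nat.le_induction with
    | base => norm_num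
    | succ m hm ih =>
      have hstep : 9 * ((m + 2) * (2 * m + 7)) ≤ 16 * ((m + 1) * (2 * m + 3)) := by nlinarith
      calc (m + 1 + 1) * (2 * (m + 1) + 5) * (2 * (m + 1) + 3) * 3 ^ (2 * (m + 1) + 1)
          = 9 * ((m + 2) * (2 * m + 7)) * ((2 * m + 5) * 3 ^ (2 * m + 1)) := by ring
        _ ≤ 16 * ((m + 1) * (2 * m + 3)) * ((2 * m + 5) * 3 ^ (2 * m + 1)) := by gcongr
        _ = 16 * ((m + 1) * (2 * m + 5) * (2 * m + 3) * 3 ^ (2 * m + 1)) := by ring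
        _ ≤ 16 * (64 * 4 ^ (2 * m + 1)) := by gcongr
        _ = 64 * 4 ^ (2 * (m + 1) + 1) := by ring

lemma chart_degree_bound {n p i d : ℕ} (hp : 0 < p) (hd : 2 ≤ d) (hi : 2 ≤ i)
    (hi2 : i ≤ n - p + 1) :
    p * ((n + p + 2) * ((d + 1) ^ (p + (n - i)) * ((p + (n - i)) * (d - 1) + 2))) ≤
      d ^ (4 * n) := by
  obtain ⟨m, rfl⟩ : ∃ m, n = m + 2 := ⟨n - 2, by omega⟩
  obtain ⟨r, rfl⟩ : ∃ r, d = r + 1 := ⟨d - 1, by omega⟩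
  have hk : p + (m + 2 - i) ≤ 2 * m + 1 := by omega
  have h1 : p * ((m + 2 + p + 2) * ((r + 1 + 1) ^ (p + (m + 2 - i)) *
      ((p + (m + 2 - i)) * (r + 1 - 1) + 2))) ≤
      (m + 1) * ((2 * m + 5) * ((r + 2) ^ (2 * m + 1) * ((2 * m + 3) * r))) := by
    gcongr ?_ * (?_ * (?_ * ?_))
    · omega
    · omega
    · exact Nat.pow_le_pow_right (by omega) hk
    · have := Nat.mul_le_mul_right r hk
      rw [Nat.add_sub_cancel]
      nlinarith
  refine h1.trans (Nat.le_of_mul_le_mul_left ?_ (show 0 < 4 ^ (2 * m + 2) by positivity))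
  calc 4 ^ (2 * m + 2) *
        ((m + 1) * ((2 * m + 5) * ((r + 2) ^ (2 * m + 1) * ((2 * m + 3) * r))))
      = (m + 1) * (2 * m + 5) * (2 * m + 3) * (4 * (r + 2)) ^ (2 * m + 1) * (4 * r) := by
        rw [mul_pow]; ring
    _ ≤ (m + 1) * (2 * m + 5) * (2 * m + 3) * (3 * (r + 1) ^ 2) ^ (2 * m + 1) * (r + 1) ^ 2 := by
        have h3 : 4 * (r + 2) ≤ 3 * (r + 1) ^ 2 := by nlinarith
        have h4 : 4 * r ≤ (r + 1) ^ 2 := by nlinarith [sq_nonneg ((r : ℤ) - 1)]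
        exact Nat.mul_le_mul (Nat.mul_le_mul_left _ (Nat.pow_le_pow_left h3 _)) h4
    _ = ((m + 1) * (2 * m + 5) * (2 * m + 3) * 3 ^ (2 * m + 1)) * (r + 1) ^ (4 * m + 4) := by
        rw [mul_pow, ← pow_mul]; ring
    _ ≤ (64 * 4 ^ (2 * m + 1)) * (r + 1) ^ (4 * m + 4) :=
        Nat.mul_le_mul_right _ (mul_three_pow_le_four_pow m)
    _ = 4 ^ (2 * m + 2) * (2 ^ 4 * (r + 1) ^ (4 * m + 4)) := by ring
    _ ≤ 4 ^ (2 * m + 2) * ((r + 1) ^ 4 * (r + 1) ^ (4 * m + 4)) := by gcongr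
    _ = 4 ^ (2 * m + 2) * (r + 1) ^ (4 * (m + 2)) := by ring

lemma isRegularValueOn_iff {ι σ : Type*} [Fintype ι] [Fintype σ]
    (G : ι → MvPolynomial σ ℂ) (U : Set (σ → ℂ)) :
    IsRegularValueOn G U ↔ ∀ y ∈ U, (∀ j, eval y (G j) = 0) →
      ∀ b : ι → ℂ, (∀ k, ∑ j, b j * eval y (pderiv k (G j)) = 0) → b = 0 := by
  refine forall₃_congr fun y _ _ => ?_
  rw [Matrix.rank_eq_finrank_span_row, eq_comm, ← Set.finrank,
    ← linearIndependent_iff_card_eq_finrank_span, Fintype.linearIndependent_iff]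
  refine forall_congr' fun b => ?_
  simp [funext_iff, jacEval, Matrix.row]

lemma pderiv_inr_rename_inl {α β : Type*} (k : β) (f : MvPolynomial α ℂ) :
    pderiv (Sum.inr k) (rename (Sum.inl : α → α ⊕ β) f) = 0 := by
  induction f using MvPolynomial.induction_on with
  | C c => simp
  | add p q hp hq => simp [hp, hq]
  | mul_X p a hp => simp [hp, pderiv_X_of_ne]

section hSys

variable {n p : ℕ} (G : Fin p → MvPolynomial (Fin n) ℂ) (i : ℕ)

lemma pderiv_inl_lagEntry (c : Fin (n - i)) (k : Fin n) :
    pderiv (Sum.inl k) (lagEntry G i c) =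
      ∑ j, X (Sum.inr j) * rename Sum.inl (pderiv k (pderiv (colIdx n i c) (G j))) := by
  simp [lagEntry, pderiv_rename Sum.inl_injective]

lemma pderiv_inr_lagEntry (c : Fin (n - i)) (k : Fin p) :
    pderiv (Sum.inr k) (lagEntry G i c) = rename Sum.inl (pderiv (colIdx n i c) (G k)) := by
  classical
  simp [lagEntry, pderiv_inr_rename_inl, pderiv_X, Pi.single_apply]

lemma totalDegree_hSys_le {d : ℕ} (hd : 0 < d) (hG : ∀ j, (G j).totalDegree ≤ d)
    (a : Fin p ⊕ Fin (n - i)) : (hSys G i a).totalDegree ≤ d := by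
  rcases a with j | c
  · exact (totalDegree_rename_le _ _).trans (hG j)
  · rw [hSys, Sum.elim_inr, lagEntry]
    refine totalDegree_finsetSum_le fun j _ => (totalDegree_mul _ _).trans ?_
    have h1 := totalDegree_rename_le (Sum.inl : Fin n → Fin n ⊕ Fin p)
      (pderiv (colIdx n i c) (G j))
    have h2 := totalDegree_pderiv_le (colIdx n i c) (G j)
    have h3 := hG j
    rw [totalDegree_X]
    omega

/-- The point obtained by multiplying the Lagrange multipliers by `c`. -/
def scaleMult (c : ℂ) (y : Fin n ⊕ Fin p → ℂ) : Fin n ⊕ Fin p → ℂ :=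
  Sum.elim (fun k => y (Sum.inl k)) fun j => c * y (Sum.inr j)

variable (c : ℂ) (y : Fin n ⊕ Fin p → ℂ)

lemma eval_scaleMult_rename (f : MvPolynomial (Fin n) ℂ) :
    eval (scaleMult c y) (rename Sum.inl f) = eval y (rename Sum.inl f) := by
  rw [eval_rename, eval_rename]; rfl

lemma eval_scaleMult_sum {α : Type*} (s : Finset α) (j : α → Fin p)
    (f : α → MvPolynomial (Fin n) ℂ) :
    eval (scaleMult c y) (∑ a ∈ s, X (Sum.inr (j a)) * rename Sum.inl (f a)) =
      c * eval y (∑ a ∈ s, X (Sum.inr (j a)) * rename Sum.inl (f a)) := by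
  simp only [map_sum, map_mul, eval_scaleMult_rename, eval_X, Finset.mul_sum]
  simp [scaleMult, mul_assoc]

lemma hSys_scaleMult (h : ∀ a, eval y (hSys G i a) = 0) (a : Fin p ⊕ Fin (n - i)) :
    eval (scaleMult c y) (hSys G i a) = 0 := by
  rcases a with j | a
  · exact (eval_scaleMult_rename c y _).trans (h (Sum.inl j))
  · have h' : eval y (lagEntry G i a) = 0 := h (Sum.inr a)
    rw [hSys, Sum.elim_inr, lagEntry, eval_scaleMult_sum c y _ (fun j => j), ← lagEntry, h',
      mul_zero]

/-- The linear relations between the gradients of coordinates and of the system `hSys`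
are preserved, up to rescaling, by `scaleMult`. -/
lemma relation_scaleMult {τ : Type} [Fintype τ] (s : τ → Fin n)
    (w : τ ⊕ (Fin p ⊕ Fin (n - i)) → ℂ)
    (hw : ∀ k, ∑ a, w a *
      eval y (pderiv k (Sum.elim (fun t => X (Sum.inl (s t))) (hSys G i) a)) = 0)
    (k : Fin n ⊕ Fin p) :
    ∑ a, Sum.elim (fun t => c * w (Sum.inl t)) (Sum.elim (fun j => c * w (Sum.inr (Sum.inl j)))
      fun l => w (Sum.inr (Sum.inr l))) a * eval (scaleMult c y)
        (pderiv k (Sum.elim (fun t => X (Sum.inl (s t))) (hSys G i) a)) = 0 := by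
  classical
  have h := hw k
  rcases k with k | k
  · have h' := congrArg (c * ·) h
    simp only [mul_zero] at h'
    rw [← h', Finset.mul_sum]
    refine Finset.sum_congr rfl fun a _ => ?_
    rcases a with t | j | l
    · simp [pderiv_X, Pi.single_apply, apply_ite (eval _)]
    · simp [hSys, pderiv_rename Sum.inl_injective, eval_scaleMult_rename, mul_assoc]
    · simp only [Sum.elim_inr, hSys, pderiv_inl_lagEntry, eval_scaleMult_sum c y _ (fun j => j)]
      ring
  · rw [← h]
    refine Finset.sum_congr rfl fun a _ => ?_
    rcases a with t | j | l
    · simp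
    · simp [hSys, pderiv_inr_rename_inl]
    · simp only [Sum.elim_inr, hSys, pderiv_inr_lagEntry, eval_scaleMult_rename]

end hSys

lemma eval_sub_eval_of_totalDegree_le_one {σ : Type*} [Fintype σ] {f : MvPolynomial σ ℂ}
    (hf : f.totalDegree ≤ 1) (x x₀ : σ → ℂ) :
    eval x f - eval x₀ f = ∑ k, eval x₀ (pderiv k f) * (x k - x₀ k) := by
  classical
  have key : ∀ s ∈ f.support, eval x (monomial s (coeff s f)) - eval x₀ (monomial s (coeff s f)) =
      ∑ k, eval x₀ (pderiv k (monomial s (coeff s f))) * (x k - x₀ k) := by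
    intro s hs
    have h : s.degree ≤ 1 := (le_totalDegree hs).trans hf
    rcases Nat.le_one_iff_eq_zero_or_eq_one.mp h with h | h
    · rw [Finsupp.degree_eq_zero_iff] at h
      simp [h]
    · obtain ⟨a, rfl⟩ := (Set.ext_iff.mp Finsupp.range_single_one s).mpr h
      dsimp only
      rw [← C_mul_X_eq_monomial]
      simp [pderiv_X, Pi.single_apply, apply_ite (eval x₀), mul_sub]
  conv_lhs => rw [f.as_sum, map_sum, map_sum, ← Finset.sum_sub_distrib, Finset.sum_congr rfl key]
  rw [Finset.sum_comm]
  refine Finset.sum_congr rfl fun k _ => ?_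
  conv_rhs => rw [f.as_sum, map_sum, map_sum, Finset.sum_mul]

lemma pderiv_pderiv_eq_zero {σ : Type} {f : MvPolynomial σ ℂ} (hf : f.totalDegree ≤ 1)
    (k l : σ) : pderiv k (pderiv l f) = 0 := by
  have h : (pderiv l f).totalDegree = 0 := by
    have := totalDegree_pderiv_le l f
    omega
  rw [totalDegree_eq_zero_iff_eq_C.mp h, pderiv_C]

section fiberSys

variable {n p : ℕ} {F : Fin p → MvPolynomial (Fin n) ℂ} {i : ℕ} (hin : i - 1 ≤ n)

/-- A linear relation between the gradients at `y` of the first `i - 1` coordinates and of the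
system `hSys F i`. -/
def IsGradientRelation (F : Fin p → MvPolynomial (Fin n) ℂ) (hin : i - 1 ≤ n)
    (y : Fin n ⊕ Fin p → ℂ) (w : Fin (i - 1) ⊕ (Fin p ⊕ Fin (n - i)) → ℂ) : Prop :=
  ∀ k, ∑ a, w a *
    eval y (pderiv k (Sum.elim (fun t => X (Sum.inl (Fin.castLE hin t))) (hSys F i) a)) = 0

lemma isRegularValueOn_fiberSys {σ : Fin (i - 1) → ℂ}
    (h : ∀ y : Fin n ⊕ Fin p → ℂ, y ∘ Sum.inr ≠ 0 → (∀ a, eval y (hSys F i a) = 0) →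
      (∀ t, y (Sum.inl (Fin.castLE hin t)) = σ t) →
      ∀ w, IsGradientRelation F hin y w → w = 0) :
    IsRegularValueOn (fiberSys F i hin σ) {z | z ∘ Sum.inr ≠ 0} := by
  refine (isRegularValueOn_iff _ _).mpr fun y hy hz w hw => h y hy (fun a => hz (Sum.inr a))
    (fun t => ?_) w fun k => (Finset.sum_congr rfl fun a _ => ?_).trans (hw k)
  · simpa [fiberSys, sub_eq_zero] using hz (Sum.inl t)
  · cases a <;> simp [fiberSys]

lemma IsGradientRelation.eq_zero
    (hreg : IsRegularValueOn (hSys F i) {z | z ∘ Sum.inr ≠ 0}) {y : Fin n ⊕ Fin p → ℂ}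
    (hy : y ∘ Sum.inr ≠ 0) (hz : ∀ a, eval y (hSys F i a) = 0)
    {w : Fin (i - 1) ⊕ (Fin p ⊕ Fin (n - i)) → ℂ} (hw : IsGradientRelation F hin y w)
    (h : ∀ t, w (Sum.inl t) = 0) : w = 0 := by
  have hinr := (isRegularValueOn_iff _ _).mp hreg y hy hz (w ∘ Sum.inr) fun k => by
    have := hw k
    rw [Fintype.sum_sum_type] at this
    simpa [h] using this
  funext a
  rcases a with t | a
  · exact h t
  · exact congrFun hinr a

/-- For affine `F`, the critical values lie on a hyperplane. -/
lemma exists_affine_of_totalDegree_le_one (hF : ∀ j, (F j).totalDegree ≤ 1)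
    (hreg : IsRegularValueOn (hSys F i) {z | z ∘ Sum.inr ≠ 0}) :
    ∃ Ξ : MvPolynomial (Fin (i - 1)) ℂ, Ξ ≠ 0 ∧ Ξ.totalDegree ≤ 1 ∧
      ∀ σ : Fin (i - 1) → ℂ, eval σ Ξ ≠ 0 →
        IsRegularValueOn (fiberSys F i hin σ) {z | z ∘ Sum.inr ≠ 0} := by
  classical
  by_cases hbad : ∃ y : Fin n ⊕ Fin p → ℂ, y ∘ Sum.inr ≠ 0 ∧ (∀ a, eval y (hSys F i a) = 0) ∧
      ∃ w, IsGradientRelation F hin y w ∧ w ≠ 0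
  · obtain ⟨y, hy, hz, w, hw, hw0⟩ := hbad
    obtain ⟨t₀, ht₀⟩ : ∃ t, w (Sum.inl t) ≠ 0 := by
      by_contra! h
      exact hw0 (hw.eq_zero hin hreg hy hz h)
    refine ⟨∑ t, C (w (Sum.inl t)) * (X t - C (y (Sum.inl (Fin.castLE hin t)))), fun h => ht₀ ?_,
      totalDegree_finsetSum_le fun t _ => ?_, fun σ hσ => isRegularValueOn_fiberSys hin
        fun y' _ hz' hσ' => (hσ ?_).elim⟩
    · have h' := congrArg (pderiv t₀) h
      simpa [pderiv_X, Pi.single_apply] using h'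
    · refine (totalDegree_mul _ _).trans ?_
      rw [totalDegree_C, zero_add]
      exact (totalDegree_sub_C_le _ _).trans (totalDegree_X _).le
    · have hF' : ∀ j, ∑ k, eval (y ∘ Sum.inl) (pderiv k (F j)) * (y' (Sum.inl k) - y (Sum.inl k)) =
          0 := fun j => by
        have h0 : eval (y ∘ Sum.inl) (F j) = 0 := by simpa [hSys, eval_rename] using hz (Sum.inl j)
        have h1 : eval (y' ∘ Sum.inl) (F j) = 0 := by
          simpa [hSys, eval_rename] using hz' (Sum.inl j)
        have h2 := eval_sub_eval_of_totalDegree_le_one (hF j) (y' ∘ Sum.inl) (y ∘ Sum.inl)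
        rw [h0, h1, sub_zero] at h2
        exact h2.symm
      have hrel : ∀ k, ∑ t, w (Sum.inl t) * (if Fin.castLE hin t = k then 1 else 0) +
          ∑ j, w (Sum.inr (Sum.inl j)) * eval (y ∘ Sum.inl) (pderiv k (F j)) = 0 := fun k => by
        have h := hw (Sum.inl k)
        simp only [Fintype.sum_sum_type] at h
        simpa [hSys, pderiv_inl_lagEntry, pderiv_pderiv_eq_zero (hF _),
          pderiv_rename Sum.inl_injective, eval_rename, pderiv_X, Pi.single_apply,
          apply_ite (eval y)] using h
      have h := Finset.sum_congr rfl fun k (_ : k ∈ Finset.univ) =>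
        congrArg (· * (y' (Sum.inl k) - y (Sum.inl k))) (hrel k)
      simp only [add_mul, Finset.sum_add_distrib, Finset.sum_mul, zero_mul,
        Finset.sum_const_zero] at h
      rw [Finset.sum_comm, Finset.sum_comm (s := Finset.univ (α := Fin n))
        (t := Finset.univ (α := Fin p))] at h
      simp only [mul_assoc, ← Finset.mul_sum, hF', mul_zero, Finset.sum_const_zero, add_zero,
        ite_mul, one_mul, zero_mul, Finset.sum_ite_eq, Finset.mem_univ, if_true] at h
      simpa [hσ'] using h
  · push Not at hbad
    exact ⟨1, one_ne_zero, by simp, fun σ _ => isRegularValueOn_fiberSys hin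
      fun y hy hz _ w hw => hbad y hy hz w hw⟩

/-- The critical values with nonvanishing multiplier `ℓ_j` lie on a hypersurface. -/
lemma exists_chart_polynomial {d : ℕ} (hd : 0 < d) (hi1 : 1 ≤ i) (hi2 : i ≤ n)
    (hF : ∀ j, (F j).totalDegree ≤ d)
    (hreg : IsRegularValueOn (hSys F i) {z | z ∘ Sum.inr ≠ 0}) (j : Fin p) :
    ∃ Ξ : MvPolynomial (Fin (i - 1)) ℂ, Ξ ≠ 0 ∧
      Ξ.totalDegree ≤
        (n + p + 2) * ((d + 1) ^ (p + (n - i)) * ((p + (n - i)) * (d - 1) + 2)) ∧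
      ∀ (σ : Fin (i - 1) → ℂ) (y : Fin n ⊕ Fin p → ℂ), y (Sum.inr j) ≠ 0 →
        (∀ a, eval y (hSys F i a) = 0) → (∀ t, y (Sum.inl (Fin.castLE hin t)) = σ t) →
        ∀ w, IsGradientRelation F hin y w → w ≠ 0 → eval σ Ξ = 0 := by
  let S : Option (Fin (i - 1)) → Fin n ⊕ Fin p := fun o =>
    o.elim (Sum.inr j) fun t => Sum.inl (Fin.castLE hin t)
  have hS : Function.Injective S := by
    rintro (_ | a) (_ | b) h <;> simp_all [S]
  obtain ⟨Ξ, hΞ0, hΞd, hΞ⟩ := exists_critical_value_polynomial hS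
    (by simp; omega) (by have := j.pos; simp; omega) (hSys F i) hd (totalDegree_hSys_le F i hd hF)
    none fun y hz hy => (isRegularValueOn_iff _ _).mp hreg y
      (fun h => hy (congrFun h j)) hz
  obtain ⟨Ξ', hΞ'0, hΞ'd, hΞ'⟩ := exists_coeff_vanishing hΞ0
  refine ⟨Ξ', hΞ'0, hΞ'd.trans (by simpa using hΞd), fun σ y hy hz hσ w hw hw0 =>
    hΞ' σ fun c hc => ?_⟩
  set r := c / y (Sum.inr j) with hr
  have hr0 : r ≠ 0 := div_ne_zero hc hy
  have hy' : scaleMult r y ∘ S = fun o : Option (Fin (i - 1)) => o.elim c σ := by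
    funext o
    cases o with
    | none => simp [S, scaleMult, hr, hy]
    | some t => simp [S, scaleMult, hσ]
  rw [← hy']
  refine hΞ _ (hSys_scaleMult F i r y hz) (Sum.elim
    (fun o => o.elim 0 fun t => r * w (Sum.inl t))
    (Sum.elim (fun j => r * w (Sum.inr (Sum.inl j))) fun l => w (Sum.inr (Sum.inr l)))) ?_ ?_
  · contrapose! hw0
    funext a
    rcases a with t | j | l
    · simpa [hr0] using congrFun hw0 (Sum.inl (some t))
    · simpa [hr0] using congrFun hw0 (Sum.inr (Sum.inl j))
    · simpa using congrFun hw0 (Sum.inr (Sum.inr l))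
  · intro k
    refine Eq.trans ?_ (relation_scaleMult F i r y (Fin.castLE hin) w hw k)
    simp [Fintype.sum_sum_type, Fintype.sum_option, S]

end fiberSys

/-- genericity of `H_i'`. If `0` is a regular value of
`(F, [L₁ ⋯ L_p]·jac(F,i))` where `L ≠ 0`, then there is a nonzero
`Ξ_i ∈ ℂ[S₁,…,S_{i−1}]` of degree at most `d^{4n}` such that for all `σ` with
`Ξ_i(σ) ≠ 0`, `0` is a regular value of
`(X₁−σ₁,…,X_{i−1}−σ_{i−1}, F, [L₁ ⋯ L_p]·jac(F,i))` on the set where `L ≠ 0`. -/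
theorem genericity_Hi_prime
    (n p d : ℕ) (hn : 0 < n) (hp : 0 < p) (hd : 0 < d)
    (F : Fin p → MvPolynomial (Fin n) ℂ)
    (hdeg : ∀ j, (F j).totalDegree ≤ d)
    (i : ℕ) (hi1 : 1 ≤ i) (hi2 : i ≤ n - p + 1)
    (hreg : IsRegularValueOn (hSys F i) {z | z ∘ Sum.inr ≠ 0}) :
    ∃ Ξ : MvPolynomial (Fin (i - 1)) ℂ, Ξ ≠ 0 ∧
      Ξ.totalDegree ≤ d ^ (4 * n) ∧
      ∀ σ : Fin (i - 1) → ℂ, eval σ Ξ ≠ 0 →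
        IsRegularValueOn (fiberSys F i (show i - 1 ≤ n by omega) σ)
          {z | z ∘ Sum.inr ≠ 0} := by
  have hin : i - 1 ≤ n := by omega
  rcases Nat.lt_or_ge d 2 with hd2 | hd2
  · obtain rfl : d = 1 := by omega
    simpa using exists_affine_of_totalDegree_le_one hin hdeg hreg
  rcases Nat.lt_or_ge i 2 with hi | hi
  · obtain rfl : i = 1 := by omega
    exact ⟨1, one_ne_zero, by simp, fun σ _ => isRegularValueOn_fiberSys hin
      fun y hy hz _ w hw => hw.eq_zero hin hreg hy hz fun t => t.elim0⟩
  choose Ξ hΞ0 hΞd hΞ using exists_chart_polynomial hin hd hi1 (by omega) hdeg hreg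
  refine ⟨∏ j, Ξ j, Finset.prod_ne_zero_iff.mpr fun j _ => hΞ0 j, ?_, fun σ hσ =>
    isRegularValueOn_fiberSys hin fun y hy hz hyσ w hw => ?_⟩
  · refine (totalDegree_finsetProd _ _).trans ((Finset.sum_le_sum fun j _ => hΞd j).trans ?_)
    simpa using chart_degree_bound hp hd2 hi hi2
  · by_contra hw0
    obtain ⟨j, hj⟩ := Function.ne_iff.mp hy
    rw [map_prod, Finset.prod_ne_zero_iff] at hσ
    exact hσ j (Finset.mem_univ j) (hΞ j σ y hj hz hyσ w hw hw0)

end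
end

section
/- Let N, q, r, s be positive integers with q ≤ r, let 𝐀 be a q×r matrix with entries in ℂ[Y₁,…,Y_N], let B = (b₁,…,b_s) be polynomials in ℂ[Y₁,…,Y_N], and set S = {y ∈ ℂ^N : b₁(y) = ⋯ = b_s(y) = 0 and rank 𝐀(y) < q}. Assume S is finite. Then there exist at most |S| nonzero linear forms λ₁,…,λ_K on ℂ^q such that for every u ∈ ℂ^q with λ_k(u) ≠ 0 for all k, the projection μ(Z_u) equals S exactly: every y ∈ S is the projection of some common zero of 𝔏(𝐀,B,u), and every common zero of 𝔏(𝐀,B,u) projects into S; here Z_u ⊆ ℂ^{N+q} is the common zero set of 𝔏(𝐀,B,u) and μ(y,ℓ) = y. -/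
open MvPolynomial

noncomputable section

variable (N q r s : ℕ)
variable (A : Matrix (Fin q) (Fin r) (MvPolynomial (Fin N) ℂ))
variable (B : Fin s → MvPolynomial (Fin N) ℂ)

/-- The determinantal set `S = {y ∈ ℂ^N : B(y) = 0 and rank 𝐀(y) < q}`. -/
def detSet : Set (Fin N → ℂ) :=
  {y | (∀ j, eval y (B j) = 0) ∧ (A.map (eval y)).rank < q}

/-- The projection `μ(Z_u)` to `ℂ^N` of the common zero set `Z_u ⊆ ℂ^{N+q}` of the
Lagrange system `𝔏(𝐀,B,u)`. -/
def muZu (u : Fin q → ℂ) : Set (Fin N → ℂ) :=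
  {y | ∃ ℓ : Fin q → ℂ,
    (∀ j, eval y (B j) = 0) ∧
    (∀ c : Fin r, ∑ k, ℓ k * eval y (A k c) = 0) ∧
    (∑ k, u k * ℓ k = 1)}

open Matrix in
/-- A matrix over a field has rank less than its number of rows iff it has a nonzero left
null vector. -/
theorem Matrix.rank_lt_card_iff_exists_vecMul_eq_zero {m n F : Type*} [Fintype m] [Fintype n]
    [Field F] (M : Matrix m n F) :
    M.rank < Fintype.card m ↔ ∃ v : m → F, v ≠ 0 ∧ v ᵥ* M = 0 := by
  have hrank : M.rank = Fintype.card m ↔ LinearIndependent F M.row := by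
    rw [linearIndependent_iff_card_eq_finrank_span, M.rank_eq_finrank_span_row, eq_comm]
    rfl
  rw [M.rank_le_card_height.lt_iff_ne, Ne, hrank, ← Matrix.vecMul_injective_iff,
    ← Matrix.coe_vecMulLinear, injective_iff_map_eq_zero]
  simp only [Matrix.vecMulLinear_apply, not_forall, exists_prop, and_comm, ne_eq]

/-- if `S` is finite, there exist at most `|S|` nonzero linear forms
`λ₁,…,λ_K` on `ℂ^q` such that for every `u` with `λ_k(u) ≠ 0` for all `k`, the
projection of the zero set of the Lagrange system `𝔏(𝐀,B,u)` is exactly `S`. -/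
theorem lagrange_projection_exact_of_finite
    (hN : 0 < N) (hq : 0 < q) (hr : 0 < r) (hs : 0 < s) (hqr : q ≤ r)
    (hfin : (detSet N q r s A B).Finite) :
    ∃ (K : ℕ) (lam : Fin K → Module.Dual ℂ (Fin q → ℂ)),
      K ≤ (detSet N q r s A B).ncard ∧
      (∀ k, lam k ≠ 0) ∧
      ∀ u : Fin q → ℂ, (∀ k, lam k u ≠ 0) →
        muZu N q r s A B u = detSet N q r s A B := by
  have mem_iff (y : Fin N → ℂ) : y ∈ detSet N q r s A B ↔ (∀ j, eval y (B j) = 0) ∧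
      ∃ v : Fin q → ℂ, v ≠ 0 ∧ ∀ c, ∑ k, v k * eval y (A k c) = 0 := by
    have h := Matrix.rank_lt_card_iff_exists_vecMul_eq_zero (A.map (eval y))
    rw [Fintype.card_fin] at h
    simp only [detSet, Set.mem_ofPred_eq, h, funext_iff, Matrix.vecMul, dotProduct,
      Matrix.map_apply, Pi.zero_apply, ne_eq]
  choose hB v hv hvA using fun y : detSet N q r s A B => (mem_iff y).1 y.2
  have : Finite (detSet N q r s A B) := hfin
  let e : detSet N q r s A B ≃ Fin (detSet N q r s A B).ncard := Finite.equivFin _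
  refine ⟨_, fun k => dotProductEquiv ℂ (Fin q) (v (e.symm k)), le_rfl, fun k => ?_,
    fun u hu => Set.Subset.antisymm ?_ ?_⟩
  · exact (LinearEquiv.map_ne_zero_iff _).2 (hv _)
  · rintro y ⟨ℓ, hBy, hℓ, hu1⟩
    refine (mem_iff y).2 ⟨hBy, ℓ, ?_, hℓ⟩
    rintro rfl
    simp at hu1
  · intro y hy
    have hne : v ⟨y, hy⟩ ⬝ᵥ u ≠ 0 := by simpa using hu (e ⟨y, hy⟩)
    refine ⟨(v ⟨y, hy⟩ ⬝ᵥ u)⁻¹ • v ⟨y, hy⟩, hB ⟨y, hy⟩, fun c => ?_, ?_⟩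
    · simp only [Pi.smul_apply, smul_eq_mul, mul_assoc, ← Finset.mul_sum, hvA ⟨y, hy⟩ c, mul_zero]
    · change u ⬝ᵥ _ = 1
      rw [dotProduct_smul, dotProduct_comm u, smul_eq_mul, inv_mul_cancel₀ hne]

end
end

section
/- Let G = (g₁,…,g_N) be N polynomials in ℂ[Y₁,…,Y_N] (as many polynomials as variables). If at every common zero y ∈ ℂ^N of g₁,…,g_N the square N×N Jacobian matrix (∂g_j/∂Y_k)(y) is invertible, then the set of common zeros of g₁,…,g_N in ℂ^N is finite. -/
open MvPolynomial

noncomputable section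

/-- The square Jacobian matrix of `N` polynomials in `N` variables, evaluated at a
point. -/
def jacSquare {N : ℕ} (G : Fin N → MvPolynomial (Fin N) ℂ) (y : Fin N → ℂ) :
    Matrix (Fin N) (Fin N) ℂ :=
  Matrix.of fun j k => eval y (pderiv k (G j))

namespace MvPolynomial

variable {σ R : Type*} [Fintype σ] [CommRing R]

theorem derivation_eq_sum_pderiv {M : Type*} [AddCommGroup M] [Module R M]
    [Module (MvPolynomial σ R) M] [IsScalarTower R (MvPolynomial σ R) M]
    (D : Derivation R (MvPolynomial σ R) M) (p : MvPolynomial σ R) :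
    D p = ∑ i, pderiv i p • D (X i) := by
  classical
  let E : Derivation R (MvPolynomial σ R) M :=
    ∑ i, (LinearMap.toSpanSingleton (MvPolynomial σ R) M (D (X i))).compDer (pderiv i)
  have hE (q : MvPolynomial σ R) : E q = ∑ i, pderiv i q • D (X i) := by
    simp only [E, ← Derivation.coeFnAddMonoidHom_apply, map_sum, Finset.sum_apply]
    simp
  have h : D = E := derivation_ext fun j => by
    rw [hE, Finset.sum_eq_single j]
    · simp
    · intro i _ hij
      rw [pderiv_X_of_ne hij.symm, zero_smul]
    · simp
  rw [← hE, ← h]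

end MvPolynomial

theorem Matrix.eq_zero_of_isUnit_det_of_forall_sum_smul_eq_zero {n A M : Type*} [Fintype n]
    [DecidableEq n] [CommRing A] [AddCommGroup M] [Module A M] {J : Matrix n n A}
    (hJ : IsUnit J.det) {v : n → M} (hv : ∀ j, ∑ k, J j k • v k = 0) (i : n) : v i = 0 := by
  refine hJ.smul_eq_zero.mp ?_
  calc J.det • v i = ∑ k, (J.adjugate * J) i k • v k := by
        simp [Matrix.adjugate_mul, Matrix.one_apply]
    _ = ∑ j, J.adjugate i j • ∑ k, J j k • v k := by
        simp only [Matrix.mul_apply, Finset.sum_smul, Finset.smul_sum, mul_smul]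
        exact Finset.sum_comm
    _ = 0 := by simp [hv]

namespace MvPolynomial

theorem formallyUnramified_quotient_of_isUnit_det {n R : Type*} [Fintype n] [DecidableEq n]
    [CommRing R] {I : Ideal (MvPolynomial n R)} {G : n → MvPolynomial n R} (hG : ∀ j, G j ∈ I)
    (hdet : IsUnit (Ideal.Quotient.mk I (Matrix.of fun j k => pderiv k (G j)).det)) :
    Algebra.FormallyUnramified R (MvPolynomial n R ⧸ I) := by
  let D := (KaehlerDifferential.D R (MvPolynomial n R ⧸ I)).compAlgebraMap (MvPolynomial n R)
  have hD (p : MvPolynomial n R) :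
      D p = KaehlerDifferential.D R (MvPolynomial n R ⧸ I) (Ideal.Quotient.mk I p) := rfl
  have hX (i : n) : D (X i) = 0 := by
    rw [RingHom.map_det] at hdet
    refine Matrix.eq_zero_of_isUnit_det_of_forall_sum_smul_eq_zero hdet
      (v := fun i => D (X i)) (fun j => ?_) i
    have h := derivation_eq_sum_pderiv D (G j)
    rw [hD, Ideal.Quotient.eq_zero_iff_mem.mpr (hG j), map_zero] at h
    exact h.symm
  have hzero : D = 0 := derivation_ext fun i => by simp [hX]
  refine ⟨Submodule.subsingleton_iff (MvPolynomial n R ⧸ I) |>.mp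
    (subsingleton_of_bot_eq_top ?_)⟩
  rw [← KaehlerDifferential.span_range_derivation, eq_comm, Submodule.span_eq_bot]
  rintro _ ⟨a, rfl⟩
  obtain ⟨p, rfl⟩ := Ideal.Quotient.mk_surjective a
  rw [← hD, hzero, Derivation.zero_apply]

theorem isUnit_quotient_mk_of_forall_eval_ne_zero {σ K : Type*} [Finite σ] [Field K]
    [IsAlgClosed K] {I : Ideal (MvPolynomial σ K)} {p : MvPolynomial σ K}
    (h : ∀ y ∈ zeroLocus K I, eval y p ≠ 0) : IsUnit (Ideal.Quotient.mk I p) := by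
  by_contra hp
  obtain ⟨m, hm, hpm⟩ := exists_max_ideal_of_mem_nonunits hp
  obtain ⟨y, hy⟩ := eq_vanishingIdeal_singleton_of_isMaximal K
    (Ideal.comap_isMaximal_of_surjective (Ideal.Quotient.mk I) Ideal.Quotient.mk_surjective
      (K := m))
  have hmem (q : MvPolynomial σ K) : Ideal.Quotient.mk I q ∈ m ↔ eval y q = 0 := by
    rw [← Ideal.mem_comap, hy, mem_vanishingIdeal_singleton_iff, aeval_eq_eval]
  refine h y (fun q hq => ?_) ((hmem p).mp hpm)
  rw [aeval_eq_eval]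
  exact (hmem q).mp (by simp [Ideal.Quotient.eq_zero_iff_mem.mpr hq])

theorem finite_zeroLocus_of_finite_quotient {σ K : Type*} [Finite σ] [Field K]
    (I : Ideal (MvPolynomial σ K)) [Module.Finite K (MvPolynomial σ K ⧸ I)] :
    (zeroLocus K I).Finite := by
  let x (i : σ) : MvPolynomial σ K ⧸ I := Ideal.Quotient.mk I (X i)
  refine (Set.Finite.pi' (t := fun i => (minpoly K (x i)).rootSet K)
    fun i => (minpoly K (x i)).rootSet_finite K).subset fun y hy i => ?_
  let φ : (MvPolynomial σ K ⧸ I) →ₐ[K] K := Ideal.Quotient.liftₐ I (aeval y) hy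
  have hφ : φ (x i) = y i := aeval_X y i
  rw [Polynomial.mem_rootSet]
  refine ⟨minpoly.ne_zero (Algebra.IsIntegral.isIntegral _), ?_⟩
  rw [← hφ, Polynomial.aeval_algHom_apply, minpoly.aeval, map_zero]

end MvPolynomial

/-- if the square Jacobian of `G = (g₁,…,g_N)` is invertible at every
common zero of `g₁,…,g_N`, then the set of common zeros is finite. -/
theorem finite_zeros_of_invertible_jacobian
    (N : ℕ) (G : Fin N → MvPolynomial (Fin N) ℂ)
    (hjac : ∀ y : Fin N → ℂ, (∀ j, eval y (G j) = 0) → IsUnit (jacSquare G y)) :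
    {y : Fin N → ℂ | ∀ j, eval y (G j) = 0}.Finite := by
  let I : Ideal (MvPolynomial (Fin N) ℂ) := Ideal.span (Set.range G)
  have hzero : {y : Fin N → ℂ | ∀ j, eval y (G j) = 0} = zeroLocus ℂ I := by
    ext y
    simp [I, zeroLocus_span, aeval_eq_eval]
  have hdet : IsUnit (Ideal.Quotient.mk I (Matrix.of fun j k => pderiv k (G j)).det) := by
    refine isUnit_quotient_mk_of_forall_eval_ne_zero fun y hy => ?_
    rw [← hzero] at hy
    rw [RingHom.map_det]
    exact ((Matrix.isUnit_iff_isUnit_det _).mp (hjac y hy)).ne_zero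
  have := formallyUnramified_quotient_of_isUnit_det
    (fun j => Ideal.subset_span (Set.mem_range_self j)) hdet
  have : Module.Finite ℂ (MvPolynomial (Fin N) ℂ ⧸ I) :=
    Algebra.FormallyUnramified.finite_of_free ℂ _
  rw [hzero]
  exact finite_zeroLocus_of_finite_quotient I

end
end
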